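/- arXiv:2012.15795 — 4 statements merged into one kernel-verified Lean document; each statement's English description precedes it below -/
import Mathlib

section
/- For every n ≥ 1, the Lalanne–Kreweras map LK is well defined and is an involution: for every antichain A of the poset A^n, the set LK(A) is again an antichain of A^n, and LK(LK(A)) = A. -/
/-- `p` represents an interval `[p.1, p.2]` of the poset `Aⁿ` (so `1 ≤ p.1 ≤ p.2 ≤ n`). -/
def AnMem (n : ℕ) (p : ℕ × ℕ) : Prop := 1 ≤ p.1 ∧ p.1 ≤ p.2 ∧ p.2 ≤ n

/-- The containment order of `Aⁿ`: `AnLe p q` means `[p.1,p.2] ⊆ [q.1,q.2]`,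
i.e. `p ≤ q` in `Aⁿ`. -/
def AnLe (p q : ℕ × ℕ) : Prop := q.1 ≤ p.1 ∧ p.2 ≤ q.2

/-- `A` is an antichain of the poset `Aⁿ`: its members are intervals of `[n]`, and no two
distinct members are comparable under containment. -/
def IsAntichainAn (n : ℕ) (A : Finset (ℕ × ℕ)) : Prop :=
  (∀ p ∈ A, AnMem n p) ∧ ∀ p ∈ A, ∀ q ∈ A, p ≠ q → ¬ AnLe p q

/-- The Lalanne–Kreweras involution.  Writing the antichain `A` as
`{[i₁,j₁],…,[i_k,j_k]}` with `i₁ < ⋯ < i_k` and `j₁ < ⋯ < j_k`, the image `LK A` consists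
of the pairs `[i'_ℓ, j'_ℓ]` where `{i'_1 < ⋯ < i'_m} = [n] \ {j₁,…,j_k}` and
`{j'_1 < ⋯ < j'_m} = [n] \ {i₁,…,i_k}`: we zip the increasing enumeration of the
complement of the second coordinates with that of the first coordinates. -/
def LK (n : ℕ) (A : Finset (ℕ × ℕ)) : Finset (ℕ × ℕ) :=
  (List.zip
    ((Finset.Icc 1 n \ A.image Prod.snd).sort (· ≤ ·))
    ((Finset.Icc 1 n \ A.image Prod.fst).sort (· ≤ ·))).toFinset

instance (n : ℕ) (p : ℕ × ℕ) : Decidable (AnMem n p) := by unfold AnMem; infer_instance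

instance (p q : ℕ × ℕ) : Decidable (AnLe p q) := by unfold AnLe; infer_instance

instance (n : ℕ) (A : Finset (ℕ × ℕ)) : Decidable (IsAntichainAn n A) := by
  unfold IsAntichainAn; infer_instance

/-- The number of elements of `S` smaller than `x`. -/
def rankBelow (S : Finset ℕ) (x : ℕ) : ℕ := (S.filter (· < x)).card

theorem rankBelow_mono (S : Finset ℕ) : Monotone (rankBelow S) := fun _ _ h =>
  Finset.card_le_card (Finset.monotone_filter_right S fun _ _ hx => lt_of_lt_of_le hx h)

theorem rankBelow_lt {S : Finset ℕ} {a b : ℕ} (ha : a ∈ S) (h : a < b) :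
    rankBelow S a < rankBelow S b := by
  refine Finset.card_lt_card ⟨Finset.monotone_filter_right S fun _ _ hx => lt_trans hx h, ?_⟩
  intro hs
  simpa using hs (Finset.mem_filter.2 ⟨ha, h⟩)

theorem rankBelow_inj {S : Finset ℕ} {a b : ℕ} (ha : a ∈ S) (hb : b ∈ S)
    (h : rankBelow S a = rankBelow S b) : a = b := by
  rcases lt_trichotomy a b with hab | hab | hab
  · exact absurd h (rankBelow_lt ha hab).ne
  · exact hab
  · exact absurd h (rankBelow_lt hb hab).ne'

theorem rankBelow_sdiff_add {S U : Finset ℕ} (h : S ⊆ U) (x : ℕ) :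
    rankBelow (U \ S) x + rankBelow S x = rankBelow U x := by
  unfold rankBelow
  rw [← Finset.card_union_of_disjoint
    (Finset.disjoint_filter_filter Finset.sdiff_disjoint), ← Finset.filter_union,
    Finset.sdiff_union_of_subset h]

theorem rankBelow_image {α : Type*} (A : Finset α) (f : α → ℕ)
    (hf : Set.InjOn f A) (x : ℕ) :
    rankBelow (A.image f) x = (A.filter (f · < x)).card := by
  unfold rankBelow
  rw [Finset.filter_image, Finset.card_image_of_injOn]
  exact hf.mono (Finset.coe_subset.2 (Finset.filter_subset _ _))

theorem rankBelow_orderEmbOfFin (S : Finset ℕ) {k : ℕ} (h : S.card = k) (i : Fin k) :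
    rankBelow S (S.orderEmbOfFin h i) = i := by
  have key : S.filter (· < S.orderEmbOfFin h i) =
      (Finset.Iio i).map (S.orderEmbOfFin h).toEmbedding := by
    conv_lhs => enter [2]; rw [← Finset.map_orderEmbOfFin_univ S h]
    ext x
    simp only [Finset.mem_filter, Finset.mem_map, Finset.mem_univ, true_and, Finset.mem_Iio]
    constructor
    · rintro ⟨⟨j, rfl⟩, hj⟩
      exact ⟨j, (S.orderEmbOfFin h).lt_iff_lt.1 hj, rfl⟩
    · rintro ⟨j, hj, rfl⟩
      exact ⟨⟨j, rfl⟩, (S.orderEmbOfFin h).lt_iff_lt.2 hj⟩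
  rw [rankBelow, key, Finset.card_map, Fin.card_Iio]

theorem rankBelow_sort_getElem (S : Finset ℕ) (i : ℕ) (hi : i < (S.sort (· ≤ ·)).length) :
    rankBelow S ((S.sort (· ≤ ·))[i]) = i :=
  rankBelow_orderEmbOfFin S rfl ⟨i, by simpa using hi⟩

/-- The set of pairs matching the increasing enumerations of `S` and `T`. -/
def sortedZip (S T : Finset ℕ) : Finset (ℕ × ℕ) :=
  (List.zip (S.sort (· ≤ ·)) (T.sort (· ≤ ·))).toFinset

theorem mem_sortedZip {S T : Finset ℕ} {p : ℕ × ℕ} :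
    p ∈ sortedZip S T ↔ p.1 ∈ S ∧ p.2 ∈ T ∧ rankBelow S p.1 = rankBelow T p.2 := by
  obtain ⟨a, b⟩ := p
  simp only [sortedZip, List.mem_toFinset]
  constructor
  · intro h
    obtain ⟨i, hi, he⟩ := List.mem_iff_getElem.1 h
    rw [List.getElem_zip, Prod.mk.injEq] at he
    obtain ⟨rfl, rfl⟩ := he
    refine ⟨(Finset.mem_sort (· ≤ ·)).1 (List.getElem_mem _),
      (Finset.mem_sort (· ≤ ·)).1 (List.getElem_mem _), ?_⟩
    rw [rankBelow_sort_getElem, rankBelow_sort_getElem]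
  · rintro ⟨ha, hb, h⟩
    obtain ⟨i, hi, rfl⟩ := List.mem_iff_getElem.1 ((Finset.mem_sort (· ≤ ·)).2 ha)
    obtain ⟨j, hj, rfl⟩ := List.mem_iff_getElem.1 ((Finset.mem_sort (· ≤ ·)).2 hb)
    simp only [rankBelow_sort_getElem] at h
    subst h
    exact List.mem_iff_getElem.2 ⟨i, by simpa using ⟨by simpa using hi, by simpa using hj⟩,
      List.getElem_zip⟩

theorem image_fst_sortedZip {S T : Finset ℕ} (h : S.card = T.card) :
    (sortedZip S T).image Prod.fst = S := by
  have hmap := List.map_fst_zip (l₁ := S.sort (· ≤ ·)) (l₂ := T.sort (· ≤ ·)) (by simp [h])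
  ext x
  rw [← Finset.mem_sort (s := S) (· ≤ ·), ← hmap]
  simp [sortedZip]

theorem image_snd_sortedZip {S T : Finset ℕ} (h : S.card = T.card) :
    (sortedZip S T).image Prod.snd = T := by
  have hmap := List.map_snd_zip (l₁ := S.sort (· ≤ ·)) (l₂ := T.sort (· ≤ ·)) (by simp [h])
  ext x
  rw [← Finset.mem_sort (s := T) (· ≤ ·), ← hmap]
  simp [sortedZip]

theorem eq_of_mem_sortedZip_of_anLe {S T : Finset ℕ} {p q : ℕ × ℕ}
    (hp : p ∈ sortedZip S T) (hq : q ∈ sortedZip S T) (h : AnLe p q) : p = q := by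
  obtain ⟨hp1, hp2, hpr⟩ := mem_sortedZip.1 hp
  obtain ⟨hq1, hq2, hqr⟩ := mem_sortedZip.1 hq
  have h1 := rankBelow_mono S h.1
  have h2 := rankBelow_mono T h.2
  exact Prod.ext (rankBelow_inj hp1 hq1 (by omega)) (rankBelow_inj hp2 hq2 (by omega))

namespace IsAntichainAn

variable {n : ℕ} {A : Finset (ℕ × ℕ)}

theorem eq_of_anLe (hA : IsAntichainAn n A) {p q : ℕ × ℕ} (hp : p ∈ A) (hq : q ∈ A)
    (h : AnLe p q) : p = q :=
  by_contra fun hne => hA.2 p hp q hq hne h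

theorem injOn_fst (hA : IsAntichainAn n A) : Set.InjOn Prod.fst (A : Set (ℕ × ℕ)) := by
  intro p hp q hq h
  rcases le_total p.2 q.2 with h2 | h2
  · exact hA.eq_of_anLe hp hq ⟨h.ge, h2⟩
  · exact (hA.eq_of_anLe hq hp ⟨h.le, h2⟩).symm

theorem injOn_snd (hA : IsAntichainAn n A) : Set.InjOn Prod.snd (A : Set (ℕ × ℕ)) := by
  intro p hp q hq h
  rcases le_total q.1 p.1 with h1 | h1
  · exact hA.eq_of_anLe hp hq ⟨h1, h.le⟩
  · exact (hA.eq_of_anLe hq hp ⟨h1, h.ge⟩).symm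

theorem fst_lt_iff (hA : IsAntichainAn n A) {p q : ℕ × ℕ} (hp : p ∈ A) (hq : q ∈ A) :
    p.1 < q.1 ↔ p.2 < q.2 := by
  constructor <;> intro h <;> by_contra! h'
  · have := hA.eq_of_anLe hq hp ⟨h.le, h'⟩
    simp [this] at h
  · have := hA.eq_of_anLe hp hq ⟨h', h.le⟩
    simp [this] at h

theorem sortedZip_image (hA : IsAntichainAn n A) :
    sortedZip (A.image Prod.fst) (A.image Prod.snd) = A := by
  have hrank : ∀ p ∈ A,
      rankBelow (A.image Prod.fst) p.1 = rankBelow (A.image Prod.snd) p.2 := by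
    intro p hp
    rw [rankBelow_image _ _ hA.injOn_fst, rankBelow_image _ _ hA.injOn_snd]
    exact congrArg _ (Finset.filter_congr fun q hq => hA.fst_lt_iff hq hp)
  ext p
  rw [mem_sortedZip]
  constructor
  · rintro ⟨h1, h2, h⟩
    obtain ⟨q, hq, hqp⟩ := Finset.mem_image.1 h1
    have hqr := hrank q hq
    rw [hqp, h] at hqr
    have := rankBelow_inj h2 (Finset.mem_image_of_mem _ hq) hqr
    rwa [Prod.ext hqp.symm this]
  · exact fun hp => ⟨Finset.mem_image_of_mem _ hp, Finset.mem_image_of_mem _ hp, hrank p hp⟩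

theorem rankBelow_snd_le (hA : IsAntichainAn n A) (x : ℕ) :
    rankBelow (A.image Prod.snd) x ≤ rankBelow (A.image Prod.fst) x := by
  rw [rankBelow_image _ _ hA.injOn_fst, rankBelow_image _ _ hA.injOn_snd]
  exact Finset.card_le_card (Finset.monotone_filter_right A fun p hp h =>
    lt_of_le_of_lt (hA.1 p hp).2.1 h)

theorem image_fst_subset (hA : IsAntichainAn n A) : A.image Prod.fst ⊆ Finset.Icc 1 n :=
  Finset.image_subset_iff.2 fun p hp =>
    Finset.mem_Icc.2 ⟨(hA.1 p hp).1, (hA.1 p hp).2.1.trans (hA.1 p hp).2.2⟩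

theorem image_snd_subset (hA : IsAntichainAn n A) : A.image Prod.snd ⊆ Finset.Icc 1 n :=
  Finset.image_subset_iff.2 fun p hp =>
    Finset.mem_Icc.2 ⟨(hA.1 p hp).1.trans (hA.1 p hp).2.1, (hA.1 p hp).2.2⟩

theorem card_compl_eq (hA : IsAntichainAn n A) :
    (Finset.Icc 1 n \ A.image Prod.snd).card = (Finset.Icc 1 n \ A.image Prod.fst).card := by
  rw [Finset.card_sdiff_of_subset hA.image_snd_subset,
    Finset.card_sdiff_of_subset hA.image_fst_subset,
    Finset.card_image_of_injOn hA.injOn_fst, Finset.card_image_of_injOn hA.injOn_snd]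

theorem lk (hA : IsAntichainAn n A) : IsAntichainAn n (LK n A) := by
  refine ⟨fun p hp => ?_, fun p hp q hq hne h => hne (eq_of_mem_sortedZip_of_anLe hp hq h)⟩
  obtain ⟨h1, h2, h⟩ := mem_sortedZip.1 hp
  refine ⟨(Finset.mem_Icc.1 (Finset.mem_sdiff.1 h1).1).1, ?_,
    (Finset.mem_Icc.1 (Finset.mem_sdiff.1 h2).1).2⟩
  by_contra! hlt
  have hstrict := rankBelow_lt h2 hlt
  have hfst := rankBelow_sdiff_add hA.image_fst_subset p.1
  have hsnd := rankBelow_sdiff_add hA.image_snd_subset p.1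
  have hle := hA.rankBelow_snd_le p.1
  omega

theorem lk_lk (hA : IsAntichainAn n A) : LK n (LK n A) = A := by
  change sortedZip (Finset.Icc 1 n \ (sortedZip _ _).image Prod.snd)
    (Finset.Icc 1 n \ (sortedZip _ _).image Prod.fst) = A
  rw [image_fst_sortedZip hA.card_compl_eq, image_snd_sortedZip hA.card_compl_eq,
    Finset.sdiff_sdiff_eq_self hA.image_fst_subset,
    Finset.sdiff_sdiff_eq_self hA.image_snd_subset, hA.sortedZip_image]

end IsAntichainAn

/-- For every `n ≥ 1`, the Lalanne–Kreweras map is well defined and is an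
involution: for every antichain `A` of `Aⁿ`, the set `LK A` is again an antichain of
`Aⁿ`, and `LK (LK A) = A`. -/
theorem stmt0 (n : ℕ) (hn : 1 ≤ n) (A : Finset (ℕ × ℕ)) (hA : IsAntichainAn n A) :
    IsAntichainAn n (LK n A) ∧ LK n (LK n A) = A :=
  ⟨hA.lk, hA.lk_lk⟩
end

section
/- For every n ≥ 1, every antichain A of A^n, and every 1 ≤ i ≤ n, one has h_i(A) + h_i(LK(A)) = 2. Consequently #A + #LK(A) = n and maj(A) + maj(LK(A)) = n(n+1). -/
/-- The statistic `h_i(A) = #{j : [i,j] ∈ A} + #{j : [j,i] ∈ A}`. -/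
def hstat (i : ℕ) (A : Finset (ℕ × ℕ)) : ℕ :=
  (A.filter (fun p => p.1 = i)).card + (A.filter (fun p => p.2 = i)).card

/-- The major index `maj(A) = ∑_{[i,j] ∈ A} (i + j)`. -/
def majA (A : Finset (ℕ × ℕ)) : ℕ := ∑ p ∈ A, (p.1 + p.2)

theorem card_filter_eq_of_injOn {α β : Type*} [DecidableEq β] {f : α → β} {S : Finset α}
    (hf : Set.InjOn f S) (b : β) :
    (S.filter (fun a => f a = b)).card = if b ∈ S.image f then 1 else 0 := by
  split_ifs with h
  · obtain ⟨a, ha, rfl⟩ := Finset.mem_image.mp h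
    rw [Finset.card_eq_one]
    refine ⟨a, Finset.ext fun c => ?_⟩
    rw [Finset.mem_filter, Finset.mem_singleton]
    exact ⟨fun hc => hf hc.1 ha hc.2, by rintro rfl; exact ⟨ha, rfl⟩⟩
  · rw [Finset.card_eq_zero, Finset.filter_eq_empty_iff]
    rintro a ha rfl
    exact h (Finset.mem_image_of_mem f ha)

theorem image_toFinset_of_map_eq {α β : Type*} [DecidableEq α] [DecidableEq β]
    {f : α → β} {L : List α} {l : List β} (h : L.map f = l) :
    L.toFinset.image f = l.toFinset := by
  subst h
  ext b
  simp

theorem injOn_toFinset_of_map_eq {α β : Type*} [DecidableEq α]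
    {f : α → β} {L : List α} {l : List β} (h : L.map f = l) (hl : l.Nodup) :
    Set.InjOn f (L.toFinset : Finset α) := by
  subst h
  intro a ha b hb
  exact List.inj_on_of_nodup_map hl (by simpa using ha) (by simpa using hb)

namespace IsAntichainAn

variable {n : ℕ} {A : Finset (ℕ × ℕ)}

theorem length_sort_compl (hA : IsAntichainAn n A) :
    ((Finset.Icc 1 n \ A.image Prod.snd).sort (· ≤ ·)).length =
      ((Finset.Icc 1 n \ A.image Prod.fst).sort (· ≤ ·)).length := by
  rw [Finset.length_sort, Finset.length_sort, Finset.card_sdiff_of_subset hA.image_snd_subset,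
    Finset.card_sdiff_of_subset hA.image_fst_subset, Finset.card_image_of_injOn hA.injOn_fst,
    Finset.card_image_of_injOn hA.injOn_snd]

theorem image_fst_LK (hA : IsAntichainAn n A) :
    (LK n A).image Prod.fst = Finset.Icc 1 n \ A.image Prod.snd :=
  (image_toFinset_of_map_eq (List.map_fst_zip hA.length_sort_compl.le)).trans
    (Finset.sort_toFinset _ _)

theorem image_snd_LK (hA : IsAntichainAn n A) :
    (LK n A).image Prod.snd = Finset.Icc 1 n \ A.image Prod.fst :=
  (image_toFinset_of_map_eq (List.map_snd_zip hA.length_sort_compl.ge)).trans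
    (Finset.sort_toFinset _ _)

theorem injOn_fst_LK (hA : IsAntichainAn n A) :
    Set.InjOn Prod.fst (LK n A : Set (ℕ × ℕ)) :=
  injOn_toFinset_of_map_eq (List.map_fst_zip hA.length_sort_compl.le) (Finset.sort_nodup _ _)

theorem injOn_snd_LK (hA : IsAntichainAn n A) :
    Set.InjOn Prod.snd (LK n A : Set (ℕ × ℕ)) :=
  injOn_toFinset_of_map_eq (List.map_snd_zip hA.length_sort_compl.ge) (Finset.sort_nodup _ _)

end IsAntichainAn

theorem hstat_eq_of_injOn {S : Finset (ℕ × ℕ)} (h1 : Set.InjOn Prod.fst (S : Set (ℕ × ℕ)))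
    (h2 : Set.InjOn Prod.snd (S : Set (ℕ × ℕ))) (i : ℕ) :
    hstat i S =
      (if i ∈ S.image Prod.fst then 1 else 0) + (if i ∈ S.image Prod.snd then 1 else 0) := by
  rw [hstat, card_filter_eq_of_injOn h1, card_filter_eq_of_injOn h2]

theorem majA_eq_of_injOn {S : Finset (ℕ × ℕ)} (h1 : Set.InjOn Prod.fst (S : Set (ℕ × ℕ)))
    (h2 : Set.InjOn Prod.snd (S : Set (ℕ × ℕ))) :
    majA S = ∑ i ∈ S.image Prod.fst, i + ∑ i ∈ S.image Prod.snd, i := by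
  rw [majA, Finset.sum_add_distrib, Finset.sum_image h1, Finset.sum_image h2]

theorem sum_Icc_one_id_mul_two (n : ℕ) : (∑ i ∈ Finset.Icc 1 n, i) * 2 = n * (n + 1) := by
  induction n with
  | zero => rfl
  | succ k ih => rw [Finset.sum_Icc_succ_top (by omega), add_mul, ih]; ring

/-- For every `n ≥ 1`, every antichain `A` of `Aⁿ` and every
`1 ≤ i ≤ n`, one has `h_i(A) + h_i(LK A) = 2`.  Consequently
`#A + #(LK A) = n` and `maj(A) + maj(LK A) = n(n+1)`. -/
theorem stmt1 (n : ℕ) (hn : 1 ≤ n) (A : Finset (ℕ × ℕ)) (hA : IsAntichainAn n A) :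
    (∀ i, 1 ≤ i → i ≤ n → hstat i A + hstat i (LK n A) = 2) ∧
    A.card + (LK n A).card = n ∧
    majA A + majA (LK n A) = n * (n + 1) := by
  refine ⟨fun i hi hin => ?_, ?_, ?_⟩
  · have hmem : i ∈ Finset.Icc 1 n := Finset.mem_Icc.mpr ⟨hi, hin⟩
    rw [hstat_eq_of_injOn hA.injOn_fst hA.injOn_snd,
      hstat_eq_of_injOn hA.injOn_fst_LK hA.injOn_snd_LK, hA.image_fst_LK, hA.image_snd_LK]
    simp only [Finset.mem_sdiff, hmem, true_and]
    split_ifs <;> rfl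
  · rw [← Finset.card_image_of_injOn hA.injOn_fst_LK, hA.image_fst_LK,
      ← Finset.card_image_of_injOn hA.injOn_snd, add_comm,
      Finset.card_sdiff_add_card_eq_card hA.image_snd_subset, Nat.card_Icc, Nat.add_sub_cancel]
  · have h1 := Finset.sum_sdiff (f := fun i => i) hA.image_fst_subset
    have h2 := Finset.sum_sdiff (f := fun i => i) hA.image_snd_subset
    have h3 := sum_Icc_one_id_mul_two n
    rw [majA_eq_of_injOn hA.injOn_fst hA.injOn_snd,
      majA_eq_of_injOn hA.injOn_fst_LK hA.injOn_snd_LK, hA.image_fst_LK, hA.image_snd_LK]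
    omega
end

section
/- Let P be a graded poset of rank r and κ > 0. Then on F^B_κ(P): (i) Rvac^B_F and DRvac^B_F are involutions; (ii) Rvac^B_F ∘ Row^B_F = (Row^B_F)^{−1} ∘ Rvac^B_F; (iii) DRvac^B_F ∘ Row^B_F = (Row^B_F)^{−1} ∘ DRvac^B_F; (iv) (Row^B_F)^{r+2} = DRvac^B_F ∘ Rvac^B_F. -/
open scoped Classical

noncomputable section

/-- `P̂`: the poset `P` with a new minimum `0̂` and a new maximum `1̂` adjoined. -/
abbrev Phat (P : Type) := WithBot (WithTop P)

instance {P : Type} [Fintype P] : Fintype (Phat P) :=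
  inferInstanceAs (Fintype (Option (Option P)))

/-- The inclusion of `P` into `P̂`. -/
def emb {P : Type} (p : P) : Phat P := ((p : WithTop P) : WithBot (WithTop P))

/-- The new maximum `1̂` of `P̂`. -/
def topHat (P : Type) : Phat P := ((⊤ : WithTop P) : WithBot (WithTop P))

variable {P : Type} [Fintype P] [PartialOrder P]

/-- `∑_{y ⋖ x} π(y)`. -/
def covSumBelow (π : Phat P → ℝ) (x : Phat P) : ℝ :=
  ∑ y : Phat P, if y ⋖ x then π y else 0

/-- `∑_{x ⋖ y} 1/π(y)`. -/
def covSumAboveInv (π : Phat P → ℝ) (x : Phat P) : ℝ :=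
  ∑ y : Phat P, if x ⋖ y then (π y)⁻¹ else 0

/-- The birational order-filter rank toggle `𝐭_i`, in simultaneous form (it agrees with the
composition of the pairwise commuting birational order filter toggles `t_p` over `p ∈ P_i`,
since a toggle `t_p` only changes the value at `p` and only reads values at `p` and at
elements covering or covered by `p`, which have different ranks). -/
def rankToggleB (rk : P → ℕ) (i : ℕ) (π : Phat P → ℝ) : Phat P → ℝ :=
  fun x =>
    if ∃ p : P, rk p = i ∧ x = emb p then
      covSumBelow π x / (π x * covSumAboveInv π x)
    else π x

/-- Apply a word of rank toggles; the head of the list is applied last, matching the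
convention that in a product `𝐭_{i_1} 𝐭_{i_2} ⋯ 𝐭_{i_k}` the rightmost factor acts first. -/
def applyB (rk : P → ℕ) : List ℕ → (Phat P → ℝ) → Phat P → ℝ
  | [] => fun π => π
  | i :: w => fun π => rankToggleB rk i (applyB rk w π)

/-- The word `𝐭_0 𝐭_1 ⋯ 𝐭_r` for rowmotion. -/
def rowWordB (r : ℕ) : List ℕ := List.range (r + 1)

/-- The word `(𝐭_r)(𝐭_{r-1} 𝐭_r) ⋯ (𝐭_0 𝐭_1 ⋯ 𝐭_r)` for rowvacuation. -/
def rvacWordB (r : ℕ) : List ℕ :=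
  (List.range (r + 1)).foldr (fun k acc => (List.range (r + 1)).drop (r - k) ++ acc) []

/-- The word `(𝐭_0)(𝐭_1 𝐭_0) ⋯ (𝐭_r 𝐭_{r-1} ⋯ 𝐭_0)` for dual rowvacuation. -/
def drvacWordB (r : ℕ) : List ℕ :=
  (List.range (r + 1)).foldr (fun k acc => (List.range (k + 1)).reverse ++ acc) []

/-- Birational order filter rowmotion `Row^B_F = 𝐭_0 𝐭_1 ⋯ 𝐭_r`. -/
def RowB (rk : P → ℕ) (r : ℕ) : (Phat P → ℝ) → Phat P → ℝ := applyB rk (rowWordB r)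

/-- The inverse of birational order filter rowmotion, `(Row^B_F)⁻¹ = 𝐭_r ⋯ 𝐭_1 𝐭_0`
(each toggle is an involution, so the reversed word gives the inverse map). -/
def RowInvB (rk : P → ℕ) (r : ℕ) : (Phat P → ℝ) → Phat P → ℝ := applyB rk (rowWordB r).reverse

/-- Birational order filter rowvacuation `Rvac^B_F`. -/
def RvacB (rk : P → ℕ) (r : ℕ) : (Phat P → ℝ) → Phat P → ℝ := applyB rk (rvacWordB r)

/-- Birational order filter dual rowvacuation `DRvac^B_F`. -/
def DRvacB (rk : P → ℕ) (r : ℕ) : (Phat P → ℝ) → Phat P → ℝ := applyB rk (drvacWordB r)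

end

section ToggleWords

variable {G : Type*} [Group G] {t : ℕ → G}

/-- An element commuting with every letter of a word commutes with the product of the word. -/
theorem commute_prod_map {g : G} {w : List ℕ} (h : ∀ i ∈ w, Commute g (t i)) :
    Commute g (w.map t).prod := by
  refine Commute.list_prod_right _ _ fun x hx => ?_
  obtain ⟨i, hi, rfl⟩ := List.mem_map.1 hx
  exact h i hi

/-- For a word in involutions, reversing the word inverts its product. -/
theorem prod_map_reverse (hinv : ∀ i, t i * t i = 1) (w : List ℕ) :
    (w.reverse.map t).prod = (w.map t).prod⁻¹ := by
  induction w with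
  | nil => simp
  | cons i w ih =>
    have hi : (t i)⁻¹ = t i := inv_eq_of_mul_eq_one_left (hinv i)
    rw [List.reverse_cons, List.map_append, List.prod_append, ih, List.map_cons (l := w),
      List.prod_cons (l := w.map t), mul_inv_rev, hi]
    simp

/-- The word `(0)(1 0) ⋯ (n-1 ⋯ 1 0)`. -/
def staircase (n : ℕ) : List ℕ := (List.range n).flatMap fun k => (List.range (k + 1)).reverse

theorem staircase_succ (n : ℕ) :
    staircase (n + 1) = staircase n ++ (List.range (n + 1)).reverse := by
  simp [staircase, List.range_succ]

theorem lt_of_mem_staircase {n i : ℕ} (h : i ∈ staircase n) : i < n := by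
  simp only [staircase, List.mem_flatMap, List.mem_reverse, List.mem_range] at h
  omega

/-- The product of a staircase word can also be built by adding ascending words on the left. -/
theorem prod_staircase_succ
    (hcomm : ∀ i j, i + 2 ≤ j → Commute (t i) (t j)) (n : ℕ) :
    ((staircase (n + 1)).map t).prod =
      ((List.range (n + 1)).map t).prod * ((staircase n).map t).prod := by
  induction n with
  | zero => simp [staircase]
  | succ n ih =>
    have hc : Commute (t (n + 1)) ((staircase n).map t).prod :=
      commute_prod_map fun i hi => (hcomm i (n + 1) (by have := lt_of_mem_staircase hi; omega)).symm
    have hr : ((List.range (n + 1 + 1)).reverse.map t).prod =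
        t (n + 1) * ((List.range (n + 1)).reverse.map t).prod := by
      simp [List.range_succ]
    have hs : ((staircase (n + 1)).map t).prod =
        ((staircase n).map t).prod * ((List.range (n + 1)).reverse.map t).prod := by
      rw [staircase_succ, List.map_append, List.prod_append]
    have hl : ((List.range (n + 1 + 1)).map t).prod =
        ((List.range (n + 1)).map t).prod * t (n + 1) := by
      rw [List.range_succ]; simp
    rw [staircase_succ, List.map_append, List.prod_append, hr, ih, hl, mul_assoc, mul_assoc,
      ← mul_assoc _ (t (n + 1)), ← hc.eq, mul_assoc, ← hs, ih]

theorem prod_staircase_mul_self (hinv : ∀ i, t i * t i = 1)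
    (hcomm : ∀ i j, i + 2 ≤ j → Commute (t i) (t j)) (n : ℕ) :
    ((staircase n).map t).prod * ((staircase n).map t).prod = 1 := by
  induction n with
  | zero => simp [staircase]
  | succ n ih =>
    nth_rw 2 [prod_staircase_succ hcomm]
    rw [staircase_succ, List.map_append, List.prod_append, prod_map_reverse hinv]
    simpa [mul_assoc] using ih

theorem prod_staircase_mul_prod_range (hinv : ∀ i, t i * t i = 1)
    (hcomm : ∀ i j, i + 2 ≤ j → Commute (t i) (t j)) (n : ℕ) :
    ((staircase n).map t).prod * ((List.range n).map t).prod =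
      ((List.range n).map t).prod⁻¹ * ((staircase n).map t).prod := by
  cases n with
  | zero => simp [staircase]
  | succ n =>
    nth_rw 2 [prod_staircase_succ hcomm]
    rw [staircase_succ, List.map_append, List.prod_append, prod_map_reverse hinv]
    simp [mul_assoc]

/-- The word `(m-1 ⋯ n-1)(m-2 ⋯ n-1) ⋯ (0 1 ⋯ n-1)`. -/
def costaircase (n m : ℕ) : List ℕ :=
  (List.range m).reverse.flatMap fun k => (List.range n).drop k

theorem costaircase_succ (n m : ℕ) :
    costaircase n (m + 1) = (List.range n).drop m ++ costaircase n m := by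
  simp [costaircase, List.range_succ]

theorem prod_staircase_mul_prod_costaircase
    (hcomm : ∀ i j, i + 2 ≤ j → Commute (t i) (t j)) {n m : ℕ} (hm : m ≤ n) :
    ((staircase m).map t).prod * ((costaircase n (m + 1)).map t).prod =
      ((List.range n).map t).prod ^ (m + 1) := by
  induction m with
  | zero => simp [staircase, costaircase]
  | succ m ih =>
    have hc : Commute ((staircase m).map t).prod (((List.range n).drop (m + 1)).map t).prod := by
      refine commute_prod_map fun j hj => (commute_prod_map fun i hi => ?_).symm
      have hi := lt_of_mem_staircase hi
      have hj : m + 1 ≤ j := by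
        obtain ⟨k, hk, rfl⟩ := List.mem_iff_getElem.1 hj
        simp
      exact (hcomm i j (by omega)).symm
    have hs : ((List.range (m + 1)).map t).prod * (((List.range n).drop (m + 1)).map t).prod =
        ((List.range n).map t).prod := by
      have ht : List.range (m + 1) = (List.range n).take (m + 1) := by
        rw [List.take_range, min_eq_left hm]
      rw [← List.prod_append, ← List.map_append, ht, List.take_append_drop]
    rw [prod_staircase_succ hcomm, costaircase_succ, List.map_append, List.prod_append,
      mul_assoc, ← mul_assoc _ _ (List.prod _), hc.eq, mul_assoc, ih (by omega), ← mul_assoc, hs,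
      ← pow_succ']

theorem prod_staircase_mul_prod_costaircase_self
    (hcomm : ∀ i j, i + 2 ≤ j → Commute (t i) (t j)) (n : ℕ) :
    ((staircase n).map t).prod * ((costaircase n n).map t).prod =
      ((List.range n).map t).prod ^ (n + 1) := by
  rw [← prod_staircase_mul_prod_costaircase hcomm le_rfl, costaircase_succ,
    List.drop_of_length_le (by simp), List.nil_append]

end ToggleWords

section Involution

variable {G : Type*} [Group G] {d e c : G} {n : ℕ}

theorem mul_pow_eq_inv_pow_mul (hdc : d * c = c⁻¹ * d) (n : ℕ) : d * c ^ n = (c ^ n)⁻¹ * d := by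
  have h : SemiconjBy d c c⁻¹ := hdc
  simpa using (h.pow_right n).eq

theorem mul_self_eq_one_of_mul_eq_pow (hd : d * d = 1) (hdc : d * c = c⁻¹ * d)
    (hde : d * e = c ^ n) : e * e = 1 := by
  obtain rfl : e = d * c ^ n := by rw [← hde, ← mul_assoc, hd, one_mul]
  nth_rw 1 [mul_pow_eq_inv_pow_mul hdc]
  rw [mul_assoc, ← mul_assoc d, hd, one_mul, inv_mul_cancel]

theorem mul_eq_inv_mul_of_mul_eq_pow (hd : d * d = 1) (hdc : d * c = c⁻¹ * d)
    (hde : d * e = c ^ n) : e * c = c⁻¹ * e := by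
  obtain rfl : e = d * c ^ n := by rw [← hde, ← mul_assoc, hd, one_mul]
  rw [mul_assoc, ← pow_succ, pow_succ', ← mul_assoc, hdc, mul_assoc]

end Involution

section Toggles

theorem emb_injective {P : Type} : Function.Injective (emb : P → Phat P) := fun p q h => by
  simpa [emb] using h

variable {P : Type} [PartialOrder P]

theorem emb_lt_emb {p q : P} : emb p < emb q ↔ p < q := by
  simp [emb]

theorem covBy_of_emb_covBy_emb {p q : P} (h : emb p ⋖ emb q) : p ⋖ q :=
  ⟨emb_lt_emb.1 h.1, fun _ h₁ h₂ => h.2 (emb_lt_emb.2 h₁) (emb_lt_emb.2 h₂)⟩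

variable [Fintype P] {rk : P → ℕ} {π : Phat P → ℝ}

theorem covSumBelow_emb_pos (hpos : ∀ x, 0 < π x) (p : P) : 0 < covSumBelow π (emb p) := by
  have hlt : ⊥ < emb p := WithBot.bot_lt_coe _
  obtain ⟨y, -, hy⟩ := exists_le_covBy_of_lt hlt
  refine Finset.sum_pos' (fun z _ => ?_) ⟨y, Finset.mem_univ _, by simp [hy, hpos]⟩
  split_ifs
  exacts [(hpos z).le, le_rfl]

theorem covSumAboveInv_emb_pos (hpos : ∀ x, 0 < π x) (p : P) :
    0 < covSumAboveInv π (emb p) := by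
  have hlt : emb p < topHat P := WithBot.coe_lt_coe.2 (WithTop.coe_lt_top _)
  obtain ⟨y, hy, -⟩ := exists_covBy_le_of_lt hlt
  refine Finset.sum_pos' (fun z _ => ?_) ⟨y, Finset.mem_univ _, by simp [hy, hpos]⟩
  split_ifs
  exacts [(inv_pos.2 (hpos z)).le, le_rfl]

theorem rankToggleB_emb (π : Phat P → ℝ) (p : P) :
    rankToggleB rk (rk p) π (emb p) =
      covSumBelow π (emb p) / (π (emb p) * covSumAboveInv π (emb p)) :=
  if_pos ⟨p, rfl, rfl⟩

theorem rankToggleB_of_ne {i : ℕ} {x : Phat P} (h : ∀ p, rk p = i → x ≠ emb p) :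
    rankToggleB rk i π x = π x :=
  if_neg fun ⟨p, hp, hx⟩ => h p hp hx

theorem rankToggleB_emb_of_ne {i : ℕ} {p : P} (h : rk p ≠ i) :
    rankToggleB rk i π (emb p) = π (emb p) :=
  rankToggleB_of_ne fun _ hq he => h (emb_injective he ▸ hq)

theorem rankToggleB_pos (hpos : ∀ x, 0 < π x) (i : ℕ) (x : Phat P) :
    0 < rankToggleB rk i π x := by
  by_cases h : ∃ p, rk p = i ∧ x = emb p
  · obtain ⟨p, rfl, rfl⟩ := h
    rw [rankToggleB_emb]
    exact div_pos (covSumBelow_emb_pos hpos p) (mul_pos (hpos _) (covSumAboveInv_emb_pos hpos p))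
  · rw [rankToggleB, if_neg h]
    exact hpos x

theorem covSumBelow_rankToggleB (hcov : ∀ x y : P, x ⋖ y → rk y = rk x + 1) {i : ℕ} {p : P}
    (h : rk p ≠ i + 1) : covSumBelow (rankToggleB rk i π) (emb p) = covSumBelow π (emb p) := by
  refine Finset.sum_congr rfl fun y _ => ?_
  split_ifs with hy
  · refine rankToggleB_of_ne fun q hq he => h ?_
    rw [← hq, hcov q p (covBy_of_emb_covBy_emb (he ▸ hy))]
  · rfl

theorem covSumAboveInv_rankToggleB (hcov : ∀ x y : P, x ⋖ y → rk y = rk x + 1) {i : ℕ} {p : P}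
    (h : rk p + 1 ≠ i) :
    covSumAboveInv (rankToggleB rk i π) (emb p) = covSumAboveInv π (emb p) := by
  refine Finset.sum_congr rfl fun y _ => ?_
  split_ifs with hy
  · rw [rankToggleB_of_ne fun q hq he => h ?_]
    rw [← hq, hcov p q (covBy_of_emb_covBy_emb (he ▸ hy))]
  · rfl

theorem rankToggleB_rankToggleB_self (hcov : ∀ x y : P, x ⋖ y → rk y = rk x + 1)
    (hpos : ∀ x, 0 < π x) (i : ℕ) : rankToggleB rk i (rankToggleB rk i π) = π := by
  funext x
  by_cases h : ∃ p, rk p = i ∧ x = emb p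
  · obtain ⟨p, rfl, rfl⟩ := h
    have hB := (covSumBelow_emb_pos hpos p).ne'
    have hA := (covSumAboveInv_emb_pos hpos p).ne'
    have hx := (hpos (emb p)).ne'
    rw [rankToggleB_emb, covSumBelow_rankToggleB hcov (by omega),
      covSumAboveInv_rankToggleB hcov (by omega), rankToggleB_emb]
    field_simp
  · simp only [rankToggleB, if_neg h]

theorem rankToggleB_comm (hcov : ∀ x y : P, x ⋖ y → rk y = rk x + 1) {i j : ℕ} (hij : i + 2 ≤ j) :
    rankToggleB rk i (rankToggleB rk j π) = rankToggleB rk j (rankToggleB rk i π) := by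
  funext x
  by_cases h : ∃ p, x = emb p
  · obtain ⟨p, rfl⟩ := h
    by_cases hi : rk p = i
    · subst hi
      rw [rankToggleB_emb, covSumBelow_rankToggleB hcov (by omega),
        covSumAboveInv_rankToggleB hcov (by omega), rankToggleB_emb_of_ne (by omega),
        rankToggleB_emb_of_ne (by omega), rankToggleB_emb]
    · by_cases hj : rk p = j
      · subst hj
        rw [rankToggleB_emb_of_ne hi, rankToggleB_emb, rankToggleB_emb,
          covSumBelow_rankToggleB hcov (by omega), covSumAboveInv_rankToggleB hcov (by omega),
          rankToggleB_emb_of_ne hi]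
      · simp only [rankToggleB_emb_of_ne hi, rankToggleB_emb_of_ne hj]
  · have h' (k : ℕ) (p : P) (_ : rk p = k) : x ≠ emb p := fun he => h ⟨p, he⟩
    simp only [rankToggleB_of_ne (h' _)]

/-- The rank toggle as a permutation of the positive labelings. -/
noncomputable def rankTogglePerm (hcov : ∀ x y : P, x ⋖ y → rk y = rk x + 1) (i : ℕ) :
    Equiv.Perm {π : Phat P → ℝ // ∀ x, 0 < π x} :=
  Function.Involutive.toPerm (fun π => ⟨rankToggleB rk i π.1, rankToggleB_pos π.2 i⟩)
    fun π => Subtype.ext (rankToggleB_rankToggleB_self hcov π.2 i)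

theorem applyB_eq (hcov : ∀ x y : P, x ⋖ y → rk y = rk x + 1) (w : List ℕ)
    (π : {π : Phat P → ℝ // ∀ x, 0 < π x}) :
    applyB rk w π.1 = ((w.map (rankTogglePerm hcov)).prod π).1 := by
  induction w with
  | nil => rfl
  | cons i w ih => exact congrArg (rankToggleB rk i) ih

theorem rankTogglePerm_mul_self (hcov : ∀ x y : P, x ⋖ y → rk y = rk x + 1) (i : ℕ) :
    rankTogglePerm hcov i * rankTogglePerm hcov i = 1 :=
  Equiv.ext fun π => Subtype.ext (rankToggleB_rankToggleB_self hcov π.2 i)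

theorem rankTogglePerm_commute (hcov : ∀ x y : P, x ⋖ y → rk y = rk x + 1) (i j : ℕ)
    (hij : i + 2 ≤ j) : Commute (rankTogglePerm hcov i) (rankTogglePerm hcov j) :=
  Equiv.ext fun _ => Subtype.ext (rankToggleB_comm hcov hij)

theorem iterate_applyB (hcov : ∀ x y : P, x ⋖ y → rk y = rk x + 1) (w : List ℕ) (n : ℕ)
    (π : {π : Phat P → ℝ // ∀ x, 0 < π x}) :
    (applyB rk w)^[n] π.1 = (((w.map (rankTogglePerm hcov)).prod ^ n) π).1 := by
  induction n with
  | zero => rfl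
  | succ n ih => rw [Function.iterate_succ_apply', ih, applyB_eq hcov, pow_succ']; rfl

end Toggles

theorem foldr_append_eq_flatMap {α β : Type*} (f : α → List β) (l : List α) :
    l.foldr (fun k acc => f k ++ acc) [] = l.flatMap f := by
  induction l with
  | nil => rfl
  | cons a l ih => simp [ih]

theorem drvacWordB_eq_staircase (r : ℕ) : drvacWordB r = staircase (r + 1) :=
  foldr_append_eq_flatMap _ _

theorem rvacWordB_eq_costaircase (r : ℕ) : rvacWordB r = costaircase (r + 1) (r + 1) := by
  have h : (List.range (r + 1)).reverse = (List.range (r + 1)).map fun k => r - k := by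
    refine List.ext_getElem (by simp) fun k _ _ => ?_
    simp
  rw [rvacWordB, foldr_append_eq_flatMap, costaircase, h, List.flatMap_map]

/-- Let `P` be a graded poset of rank `r` and `κ > 0`.  On `F^B_κ(P)`:
(i) `Rvac^B_F` and `DRvac^B_F` are involutions;
(ii) `Rvac^B_F ∘ Row^B_F = (Row^B_F)⁻¹ ∘ Rvac^B_F`;
(iii) `DRvac^B_F ∘ Row^B_F = (Row^B_F)⁻¹ ∘ DRvac^B_F`;
(iv) `(Row^B_F)^(r+2) = DRvac^B_F ∘ Rvac^B_F`. -/
theorem stmt2 {P : Type} [Fintype P] [PartialOrder P] [Nonempty P]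
    (r : ℕ) (rk : P → ℕ)
    (hmin : ∀ x : P, IsMin x → rk x = 0)
    (hcov : ∀ x y : P, x ⋖ y → rk y = rk x + 1)
    (hmax : ∀ x : P, IsMax x → rk x = r)
    (κ : ℝ) (hκ : 0 < κ)
    (π : Phat P → ℝ) (hpos : ∀ x, 0 < π x)
    (h0 : π ⊥ = 1) (h1 : π (topHat P) = κ) :
    RvacB rk r (RvacB rk r π) = π ∧
    DRvacB rk r (DRvacB rk r π) = π ∧
    RvacB rk r (RowB rk r π) = RowInvB rk r (RvacB rk r π) ∧
    DRvacB rk r (RowB rk r π) = RowInvB rk r (DRvacB rk r π) ∧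
    (RowB rk r)^[r + 2] π = DRvacB rk r (RvacB rk r π) := by
  have hinv := rankTogglePerm_mul_self hcov
  have hcomm := rankTogglePerm_commute hcov
  have hd := prod_staircase_mul_self hinv hcomm (r + 1)
  have hdc := prod_staircase_mul_prod_range hinv hcomm (r + 1)
  have hde := prod_staircase_mul_prod_costaircase_self hcomm (r + 1)
  have he := mul_self_eq_one_of_mul_eq_pow hd hdc hde
  have hec := mul_eq_inv_mul_of_mul_eq_pow hd hdc hde
  lift π to {π : Phat P → ℝ // ∀ x, 0 < π x} using hpos
  simp only [RvacB, DRvacB, RowB, RowInvB, rowWordB, drvacWordB_eq_staircase,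
    rvacWordB_eq_costaircase, applyB_eq hcov, iterate_applyB hcov, prod_map_reverse hinv,
    ← Equiv.Perm.mul_apply, he, hd, hec, hdc, hde, Equiv.Perm.one_apply, and_self]
end

section
/- Let P be a graded poset of rank r ≥ 1, κ > 0, π ∈ A^B_κ(P), and x ∈ P. If rk(x) = 0 then (Rvac^B_A π)(x) = (𝛕_0 π)(x). If rk(x) ≥ 1 then (Rvac^B_A π)(x) = ((Row^B_A)^{−1}(Rvac^B_A(π̄)))(x), where π̄ is the restriction of π to the subposet P_{≥1} of elements of rank ≥ 1 (a graded poset of rank r−1), and Row^B_A, Rvac^B_A on the right-hand side are the corresponding operators on A^B_κ(P_{≥1}). -/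
open scoped Classical

noncomputable section

variable {P : Type} [Fintype P] [PartialOrder P]

/-- The sum, over all maximal chains `C` of `P` containing `p`, of `∏_{y ∈ C} π(y)`. -/
def chainSum (π : P → ℝ) (p : P) : ℝ :=
  ∑ C ∈ Finset.univ.filter
      (fun C : Finset P => IsMaxChain (· ≤ ·) (C : Set P) ∧ p ∈ C),
    ∏ y ∈ C, π y

/-- The birational antichain rank toggle `𝛕_i`, in simultaneous form (it agrees with the
composition of the pairwise commuting birational antichain toggles `τ_p` over `p ∈ P_i`,
since in a graded poset no maximal chain contains two distinct elements of the same rank). -/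
def arankToggleB (κ : ℝ) (rk : P → ℕ) (i : ℕ) (π : P → ℝ) : P → ℝ :=
  fun x => if rk x = i then κ / chainSum π x else π x

/-- Apply a word of antichain rank toggles; the head of the list is applied last. -/
def aApplyB (κ : ℝ) (rk : P → ℕ) : List ℕ → (P → ℝ) → P → ℝ
  | [] => fun π => π
  | i :: w => fun π => arankToggleB κ rk i (aApplyB κ rk w π)

/-- The word `𝛕_r 𝛕_{r-1} ⋯ 𝛕_0` for antichain rowmotion. -/
def arowWordB (r : ℕ) : List ℕ := (List.range (r + 1)).reverse

/-- The word `(𝛕_r)(𝛕_r 𝛕_{r-1}) ⋯ (𝛕_r 𝛕_{r-1} ⋯ 𝛕_1 𝛕_0)` for antichain rowvacuation. -/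
def arvacWordB (r : ℕ) : List ℕ :=
  (List.range (r + 1)).foldr
    (fun k acc => (List.range (r + 1)).reverse.take (k + 1) ++ acc) []

/-- Birational antichain rowmotion `Row^B_A = 𝛕_r 𝛕_{r-1} ⋯ 𝛕_0`. -/
def RowAB (κ : ℝ) (rk : P → ℕ) (r : ℕ) : (P → ℝ) → P → ℝ := aApplyB κ rk (arowWordB r)

/-- Birational antichain rowvacuation `Rvac^B_A`. -/
def RvacAB (κ : ℝ) (rk : P → ℕ) (r : ℕ) : (P → ℝ) → P → ℝ := aApplyB κ rk (arvacWordB r)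

end

section PathSums

variable {P : Type} [Fintype P]

/-- The weighted count of paths `x₀ R x₁ R ⋯ R xₙ = y` with `n` steps ending at `y`. -/
noncomputable def pathSum (R : P → P → Prop) (w : P → ℝ) : ℕ → P → ℝ
  | 0, y => w y
  | n + 1, y => w y * ∑ x ∈ Finset.univ.filter (fun x => R x y), pathSum R w n x

/-- The chains for `lt` with last element `y` that meet every rank `≤ f y`. -/
noncomputable def pathChains (lt : P → P → Prop) (f : P → ℕ) (y : P) : Finset (Finset P) :=
  Finset.univ.filter fun C =>
    (∀ a ∈ C, ∀ b ∈ C, a = b ∨ lt a b ∨ lt b a) ∧ y ∈ C ∧ (∀ z ∈ C, z = y ∨ lt z y) ∧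
      ∀ i ≤ f y, ∃ z ∈ C, f z = i

theorem sum_pathChains {lt R : P → P → Prop} {f : P → ℕ}
    (htrans : ∀ a b c, lt a b → lt b c → lt a c) (hf : ∀ a b, lt a b → f a < f b)
    (hR : ∀ a b, R a b ↔ lt a b ∧ f b = f a + 1) (w : P → ℝ) (n : ℕ) (y : P) (hy : f y = n) :
    ∑ C ∈ pathChains lt f y, ∏ z ∈ C, w z = pathSum R w n y := by
  have hirr : ∀ a, ¬ lt a a := fun a h => (hf a a h).false
  induction n generalizing y with
  | zero =>
    have : pathChains lt f y = {{y}} := by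
      ext C
      simp only [pathChains, Finset.mem_filter, Finset.mem_univ, true_and, Finset.mem_singleton]
      constructor
      · rintro ⟨-, hyC, hle, -⟩
        refine Finset.eq_singleton_iff_unique_mem.2 ⟨hyC, fun z hz => ?_⟩
        rcases hle z hz with h | h
        · exact h
        · have := hf _ _ h
          omega
      · rintro rfl
        simp [hy]
    simp [this, pathSum]
  | succ n ih =>
    rw [pathSum, Finset.mul_sum]
    have key : ∀ x ∈ Finset.univ.filter (fun x => R x y),
        w y * pathSum R w n x = ∑ C ∈ pathChains lt f x, w y * ∏ z ∈ C, w z := by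
      intro x hx
      have hx' := (hR x y).1 (Finset.mem_filter.1 hx).2
      rw [← ih x (by omega), Finset.mul_sum]
    rw [Finset.sum_congr rfl key, Finset.sum_sigma']
    symm
    have hnot : ∀ x C, R x y → C ∈ pathChains lt f x → y ∉ C := by
      intro x C hx hC hyC
      have hx' := (hR x y).1 hx
      simp only [pathChains, Finset.mem_filter, Finset.mem_univ, true_and] at hC
      rcases hC.2.2.1 y hyC with h | h
      · exact hirr x (h ▸ hx'.1)
      · exact hirr x (htrans _ _ _ hx'.1 h)
    refine Finset.sum_bij (fun p _ => insert y p.2) ?_ ?_ ?_ ?_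
    · rintro ⟨x, C⟩ h
      simp only [Finset.mem_sigma, Finset.mem_filter, Finset.mem_univ, true_and] at h
      obtain ⟨hx, hC⟩ := h
      have hx' := (hR x y).1 hx
      simp only [pathChains, Finset.mem_filter, Finset.mem_univ, true_and] at hC ⊢
      obtain ⟨h1, h2, h3, h4⟩ := hC
      have hlt : ∀ z ∈ C, lt z y := fun z hz => by
        rcases h3 z hz with rfl | h
        · exact hx'.1
        · exact htrans _ _ _ h hx'.1
      refine ⟨?_, Finset.mem_insert_self _ _, ?_, ?_⟩
      · intro a ha b hb
        rcases Finset.mem_insert.1 ha with ea | ha' <;> rcases Finset.mem_insert.1 hb with eb | hb'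
        · exact .inl (ea.trans eb.symm)
        · exact .inr (.inr (ea ▸ hlt _ hb'))
        · exact .inr (.inl (eb ▸ hlt _ ha'))
        · exact h1 a ha' b hb'
      · intro z hz
        rcases Finset.mem_insert.1 hz with rfl | hz
        · exact .inl rfl
        · exact .inr (hlt _ hz)
      · intro i hi
        rcases Nat.lt_or_ge i (f y) with h | h
        · obtain ⟨z, hz, rfl⟩ := h4 i (by omega)
          exact ⟨z, Finset.mem_insert_of_mem hz, rfl⟩
        · exact ⟨y, Finset.mem_insert_self _ _, by omega⟩
    · rintro ⟨x, C⟩ h ⟨x', C'⟩ h' heq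
      simp only [Finset.mem_sigma, Finset.mem_filter, Finset.mem_univ, true_and] at h h'
      have hCC : C = C' := by
        have := congrArg (fun D => D.erase y) heq
        simpa [Finset.erase_insert (hnot x C h.1 h.2),
          Finset.erase_insert (hnot x' C' h'.1 h'.2)] using this
      subst hCC
      have hx : x = x' := by
        have h2 := h.2
        have h2' := h'.2
        simp only [pathChains, Finset.mem_filter, Finset.mem_univ, true_and] at h2 h2'
        rcases h2.2.2.1 x' h2'.2.1 with e | e
        · exact e.symm
        · rcases h2'.2.2.1 x h2.2.1 with e' | e'
          · exact e'
          · exact absurd (htrans _ _ _ e e') (hirr _)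
      subst hx
      rfl
    · intro C hC
      simp only [pathChains, Finset.mem_filter, Finset.mem_univ, true_and] at hC
      obtain ⟨h1, h2, h3, h4⟩ := hC
      obtain ⟨x, hxC, hfx⟩ := h4 n (by omega)
      have hxy : lt x y := by
        rcases h3 x hxC with rfl | h
        · omega
        · exact h
      refine ⟨⟨x, C.erase y⟩, ?_, Finset.insert_erase h2⟩
      simp only [pathChains, Finset.mem_sigma, Finset.mem_filter, Finset.mem_univ, true_and,
        Finset.mem_erase]
      refine ⟨(hR x y).2 ⟨hxy, by omega⟩, fun a ha b hb => h1 a ha.2 b hb.2,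
        ⟨by rintro rfl; omega, hxC⟩, ?_, ?_⟩
      · rintro z ⟨hzy, hz⟩
        rcases h1 z hz x hxC with h | h | h
        · exact .inl h
        · exact .inr h
        · have a1 := hf _ _ h
          have a2 := hf _ _ ((h3 z hz).resolve_left hzy)
          omega
      · intro i hi
        obtain ⟨z, hz, rfl⟩ := h4 i (by omega)
        exact ⟨z, ⟨by rintro rfl; omega, hz⟩, rfl⟩
    · rintro ⟨x, C⟩ h
      simp only [Finset.mem_sigma, Finset.mem_filter, Finset.mem_univ, true_and] at h
      rw [Finset.prod_insert (hnot x C h.1 h.2)]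

end PathSums

/-- `P` is graded of rank `r` with rank function `rk`. -/
structure IsGradedPoset {P : Type} [PartialOrder P] (r : ℕ) (rk : P → ℕ) : Prop where
  rk_of_isMin : ∀ x : P, IsMin x → rk x = 0
  rk_covBy : ∀ x y : P, x ⋖ y → rk y = rk x + 1
  rk_of_isMax : ∀ x : P, IsMax x → rk x = r

namespace IsGradedPoset

variable {P : Type} [Fintype P] [PartialOrder P] {r : ℕ} {rk : P → ℕ}

theorem strictMono (h : IsGradedPoset r rk) : StrictMono rk := by
  let := Fintype.toLocallyFiniteOrder (α := P)
  exact (strictMono_iff_forall_covBy rk).2 fun a b hab => by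
    have := h.rk_covBy a b hab
    omega

theorem covBy_iff (h : IsGradedPoset r rk) (x y : P) : x ⋖ y ↔ x < y ∧ rk y = rk x + 1 := by
  refine ⟨fun hxy => ⟨hxy.lt, h.rk_covBy x y hxy⟩, fun hxy => ⟨hxy.1, fun z h1 h2 => ?_⟩⟩
  have := h.strictMono h1
  have := h.strictMono h2
  omega

theorem rk_le (h : IsGradedPoset r rk) (x : P) : rk x ≤ r := by
  obtain ⟨m, hxm, hm⟩ := Finite.exists_le_maximal (p := fun _ : P => True) (a := x) trivial
  rw [← h.rk_of_isMax m (maximal_true.1 hm)]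
  exact h.strictMono.monotone hxm

theorem exists_covBy_above (h : IsGradedPoset r rk) {x : P} (hx : rk x < r) : ∃ y, x ⋖ y := by
  have : ¬ IsMax x := fun hm => hx.ne (h.rk_of_isMax x hm)
  obtain ⟨b, hb⟩ := not_isMax_iff.1 this
  obtain ⟨y, hy, -⟩ := exists_covBy_le_of_lt hb
  exact ⟨y, hy⟩

theorem exists_covBy_below (h : IsGradedPoset r rk) {x : P} (hx : 0 < rk x) : ∃ y, y ⋖ x := by
  have : ¬ IsMin x := fun hm => hx.ne' (h.rk_of_isMin x hm)
  obtain ⟨b, hb⟩ := not_isMin_iff.1 this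
  obtain ⟨y, -, hy⟩ := exists_le_covBy_of_lt hb
  exact ⟨y, hy⟩

theorem isMaxChain_iff (h : IsGradedPoset r rk) {C : Finset P} {p : P} (hp : p ∈ C) :
    IsMaxChain (· ≤ ·) (C : Set P) ↔
      IsChain (· ≤ ·) (C : Set P) ∧ ∀ i ≤ r, ∃ z ∈ C, rk z = i := by
  constructor
  · intro hC
    refine ⟨hC.1, ?_⟩
    let F : Flag P := Flag.ofIsMaxChain _ hC
    have hmem : ∀ z : F, (z : P) ∈ C := fun z => z.2
    have up : ∀ n, rk p + n ≤ r → ∃ z : F, rk z = rk p + n := by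
      intro n
      induction n with
      | zero => exact fun _ => ⟨⟨p, hp⟩, rfl⟩
      | succ n ih =>
        intro hn
        obtain ⟨z, hz⟩ := ih (by omega)
        have : ¬ IsMax z := fun hm => by
          have := h.rk_of_isMax _ (Flag.isMax_coe.2 hm)
          omega
        obtain ⟨b, hb⟩ := not_isMax_iff.1 this
        obtain ⟨y, hy, -⟩ := exists_covBy_le_of_lt hb
        exact ⟨y, by rw [h.rk_covBy _ _ (Flag.coe_covBy_coe.2 hy), hz]; rfl⟩
    have down : ∀ n ≤ rk p, ∃ z : F, rk z = rk p - n := by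
      intro n
      induction n with
      | zero => exact fun _ => ⟨⟨p, hp⟩, rfl⟩
      | succ n ih =>
        intro hn
        obtain ⟨z, hz⟩ := ih (by omega)
        have : ¬ IsMin z := fun hm => by
          have := h.rk_of_isMin _ (Flag.isMin_coe.2 hm)
          omega
        obtain ⟨b, hb⟩ := not_isMin_iff.1 this
        obtain ⟨y, -, hy⟩ := exists_le_covBy_of_lt hb
        have := h.rk_covBy _ _ (Flag.coe_covBy_coe.2 hy)
        exact ⟨y, by omega⟩
    intro i hi
    rcases le_total (rk p) i with hle | hle
    · obtain ⟨z, hz⟩ := up (i - rk p) (by omega)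
      exact ⟨z, hmem z, by omega⟩
    · obtain ⟨z, hz⟩ := down (rk p - i) (by omega)
      exact ⟨z, hmem z, by omega⟩
  · rintro ⟨hC, hall⟩
    refine ⟨hC, fun D hD hCD => hCD.antisymm fun c hc => ?_⟩
    obtain ⟨z, hz, hzc⟩ := hall (rk c) (h.rk_le c)
    have : z = c := by
      by_contra hne
      rcases hD (hCD hz) hc hne with hlt | hlt
      · have := h.strictMono (lt_of_le_of_ne hlt hne)
        omega
      · have := h.strictMono (lt_of_le_of_ne hlt (Ne.symm hne))
        omega
    exact this ▸ hz

theorem chainSum_mul (h : IsGradedPoset r rk) (w : P → ℝ) (p : P) :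
    chainSum w p * w p =
      pathSum (· ⋖ ·) w (rk p) p * pathSum (fun x y => y ⋖ x) w (r - rk p) p := by
  have hpr := h.rk_le
  rw [← sum_pathChains (lt := (· < ·)) (f := rk) (fun a b c => lt_trans)
      (fun a b hab => h.strictMono hab) h.covBy_iff w _ p rfl,
    ← sum_pathChains (lt := (· > ·)) (f := fun x => r - rk x) (fun a b c h1 h2 => lt_trans h2 h1)
      (fun a b hab => by
        have := h.strictMono hab
        have := hpr a
        omega)
      (fun a b => by
        rw [h.covBy_iff]
        have := hpr a
        have := hpr b
        refine and_congr_right fun hab => ?_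
        omega) w _ p rfl,
    Finset.sum_mul_sum, ← Finset.sum_product', chainSum, Finset.sum_mul]
  refine Finset.sum_bij' (fun C _ => (C.filter (· ≤ p), C.filter (p ≤ ·)))
    (fun D _ => D.1 ∪ D.2) ?_ ?_ ?_ ?_ ?_
  · intro C hC
    obtain ⟨-, hmax, hp⟩ := Finset.mem_filter.1 hC
    obtain ⟨hch, hall⟩ := (h.isMaxChain_iff hp).1 hmax
    have hcmp : ∀ a ∈ C, ∀ b ∈ C, a = b ∨ a < b ∨ b < a := fun a ha b hb => by
      rcases hch.total ha hb with hab | hab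
      · rcases hab.eq_or_lt with e | e <;> simp [e]
      · rcases hab.eq_or_lt with e | e <;> simp [e]
    simp only [pathChains, Finset.mem_product, Finset.mem_filter, Finset.mem_univ, true_and]
    refine ⟨⟨fun a ha b hb => hcmp a ha.1 b hb.1, ⟨hp, le_rfl⟩, fun z hz => hz.2.eq_or_lt, ?_⟩,
      ⟨fun a ha b hb => (hcmp a ha.1 b hb.1).imp_right Or.symm, ⟨hp, le_rfl⟩,
        fun z hz => hz.2.eq_or_lt.imp_left Eq.symm, ?_⟩⟩
    · intro i hi
      obtain ⟨z, hz, rfl⟩ := hall i (hi.trans (hpr p))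
      refine ⟨z, ⟨hz, ?_⟩, rfl⟩
      rcases hcmp z hz p hp with e | e | e
      · exact e.le
      · exact e.le
      · have := h.strictMono e
        omega
    · intro i hi
      obtain ⟨z, hz, hzi⟩ := hall (r - i) (by omega)
      have := hpr p
      refine ⟨z, ⟨hz, ?_⟩, by omega⟩
      rcases hcmp z hz p hp with e | e | e
      · exact e.ge
      · have := h.strictMono e
        omega
      · exact e.le
  · rintro ⟨D, U⟩ hDU
    simp only [pathChains, Finset.mem_product, Finset.mem_filter, Finset.mem_univ, true_and] at hDU
    obtain ⟨⟨d1, d2, d3, d4⟩, ⟨u1, u2, u3, u4⟩⟩ := hDU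
    have hp : p ∈ D ∪ U := Finset.mem_union_left _ d2
    have d3' : ∀ z ∈ D, z ≤ p := fun z hz => (d3 z hz).elim Eq.le le_of_lt
    have u3' : ∀ z ∈ U, p ≤ z := fun z hz => (u3 z hz).elim Eq.ge le_of_lt
    refine Finset.mem_filter.2 ⟨Finset.mem_univ _, (h.isMaxChain_iff hp).2 ⟨?_, ?_⟩, hp⟩
    · intro a ha b hb hne
      rcases Finset.mem_union.1 (Finset.mem_coe.1 ha) with ha | ha <;>
        rcases Finset.mem_union.1 (Finset.mem_coe.1 hb) with hb | hb
      · exact ((d1 a ha b hb).resolve_left hne).imp le_of_lt le_of_lt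
      · exact .inl ((d3' a ha).trans (u3' b hb))
      · exact .inr ((d3' b hb).trans (u3' a ha))
      · exact ((u1 a ha b hb).resolve_left hne).symm.imp le_of_lt le_of_lt
    · intro i hi
      rcases le_total i (rk p) with hle | hle
      · obtain ⟨z, hz, e⟩ := d4 i hle
        exact ⟨z, Finset.mem_union_left _ hz, e⟩
      · obtain ⟨z, hz, e⟩ := u4 (r - i) (by omega)
        have := hpr z
        exact ⟨z, Finset.mem_union_right _ hz, by omega⟩
  · intro C hC
    obtain ⟨-, hmax, hp⟩ := Finset.mem_filter.1 hC
    ext z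
    simp only [Finset.mem_union, Finset.mem_filter]
    exact ⟨fun hz => hz.elim And.left And.left,
      fun hz => (hmax.1.total hz hp).imp (And.intro hz) (And.intro hz)⟩
  · rintro ⟨D, U⟩ hDU
    simp only [pathChains, Finset.mem_product, Finset.mem_filter, Finset.mem_univ, true_and] at hDU
    obtain ⟨⟨d1, d2, d3, d4⟩, ⟨u1, u2, u3, u4⟩⟩ := hDU
    have d3' : ∀ z ∈ D, z ≤ p := fun z hz => (d3 z hz).elim Eq.le le_of_lt
    have u3' : ∀ z ∈ U, p ≤ z := fun z hz => (u3 z hz).elim Eq.ge le_of_lt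
    ext z
    · simp only [Finset.mem_union, Finset.mem_filter]
      refine ⟨?_, fun hz => ⟨.inl hz, d3' z hz⟩⟩
      rintro ⟨hz | hz, hzp⟩
      · exact hz
      · exact (le_antisymm hzp (u3' z hz)) ▸ d2
    · simp only [Finset.mem_union, Finset.mem_filter]
      refine ⟨?_, fun hz => ⟨.inr hz, u3' z hz⟩⟩
      rintro ⟨hz | hz, hzp⟩
      · exact (le_antisymm (d3' z hz) hzp) ▸ u2
      · exact hz
  · intro C hC
    obtain ⟨-, hmax, hp⟩ := Finset.mem_filter.1 hC
    have hinter : C.filter (· ≤ p) ∩ C.filter (p ≤ ·) = {p} := by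
      ext z
      simp only [Finset.mem_inter, Finset.mem_filter, Finset.mem_singleton]
      exact ⟨fun hz => le_antisymm hz.1.2 hz.2.2, by rintro rfl; simp [hp]⟩
    have hunion : C.filter (· ≤ p) ∪ C.filter (p ≤ ·) = C := by
      ext z
      simp only [Finset.mem_union, Finset.mem_filter]
      exact ⟨fun hz => hz.elim And.left And.left,
        fun hz => (hmax.1.total hz hp).imp (And.intro hz) (And.intro hz)⟩
    have := Finset.prod_union_inter (s₁ := C.filter (· ≤ p)) (s₂ := C.filter (p ≤ ·)) (f := w)
    rw [hinter, hunion, Finset.prod_singleton] at this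
    exact this

end IsGradedPoset

section DownUp

variable {P : Type} [Fintype P] [PartialOrder P]

/-- The weighted count of saturated chains from a minimal element up to `y`. -/
noncomputable def downSum (rk : P → ℕ) (w : P → ℝ) (y : P) : ℝ :=
  pathSum (· ⋖ ·) w (rk y) y

/-- The weighted count of saturated chains from `y` up to a maximal element. -/
noncomputable def upSum (r : ℕ) (rk : P → ℕ) (w : P → ℝ) (y : P) : ℝ :=
  pathSum (fun x z => z ⋖ x) w (r - rk y) y

/-- The factor of `downSum` that comes from the elements strictly below `y`. -/
noncomputable def lowSum (rk : P → ℕ) (w : P → ℝ) (y : P) : ℝ :=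
  if rk y = 0 then 1 else ∑ x ∈ Finset.univ.filter (fun x => x ⋖ y), downSum rk w x

/-- The factor of `upSum` that comes from the elements strictly above `y`. -/
noncomputable def highSum (r : ℕ) (rk : P → ℕ) (w : P → ℝ) (y : P) : ℝ :=
  if rk y = r then 1 else ∑ z ∈ Finset.univ.filter (fun z => y ⋖ z), upSum r rk w z

/-- Toggle the ranks `k, k + 1, …, k + n - 1` in this order. -/
noncomputable def sweep (κ : ℝ) (rk : P → ℕ) (k n : ℕ) (w : P → ℝ) : P → ℝ :=
  aApplyB κ rk (List.range' k n).reverse w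

theorem sweep_zero (κ : ℝ) (rk : P → ℕ) (k : ℕ) (w : P → ℝ) : sweep κ rk k 0 w = w := rfl

theorem sweep_succ (κ : ℝ) (rk : P → ℕ) (k n : ℕ) (w : P → ℝ) :
    sweep κ rk k (n + 1) w = arankToggleB κ rk (k + n) (sweep κ rk k n w) := by
  rw [sweep, List.range'_1_concat, List.reverse_append]
  rfl

theorem sweep_of_notMem (κ : ℝ) (rk : P → ℕ) (k n : ℕ) (w : P → ℝ) (y : P)
    (hy : rk y < k ∨ k + n ≤ rk y) : sweep κ rk k n w y = w y := by
  induction n with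
  | zero => rfl
  | succ n ih =>
    rw [sweep_succ, arankToggleB, if_neg (by omega), ih (by omega)]

/-- The first `k + 1` factors of rowvacuation, each of them toggling from some rank up to `r`. -/
noncomputable def rvacStage (κ : ℝ) (r : ℕ) (rk : P → ℕ) (w : P → ℝ) : ℕ → P → ℝ
  | 0 => sweep κ rk 0 (r + 1) w
  | k + 1 => sweep κ rk (k + 1) (r - k) (rvacStage κ r rk w k)

theorem rvacStage_eq_of_le (κ : ℝ) (r : ℕ) (rk : P → ℕ) (w : P → ℝ) {k m : ℕ} (hkm : k ≤ m) (y : P)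
    (hy : rk y ≤ k) : rvacStage κ r rk w m y = rvacStage κ r rk w k y := by
  induction m, hkm using Nat.le_induction with
  | base => rfl
  | succ m hm ih => rw [rvacStage, sweep_of_notMem _ _ _ _ _ _ (by omega), ih]

theorem aApplyB_append (κ : ℝ) (rk : P → ℕ) (u v : List ℕ) (w : P → ℝ) :
    aApplyB κ rk (u ++ v) w = aApplyB κ rk u (aApplyB κ rk v w) := by
  induction u with
  | nil => rfl
  | cons i u ih => simp only [List.cons_append, aApplyB, ih]

theorem RowAB_eq_sweep (κ : ℝ) (r : ℕ) (rk : P → ℕ) (w : P → ℝ) :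
    RowAB κ rk r w = sweep κ rk 0 (r + 1) w := by
  rw [RowAB, arowWordB, sweep, List.range_eq_range']

theorem RvacAB_eq_rvacStage (κ : ℝ) (r : ℕ) (rk : P → ℕ) (w : P → ℝ) :
    RvacAB κ rk r w = rvacStage κ r rk w r := by
  have take_eq : ∀ m ≤ r + 1, (List.range (r + 1)).reverse.take m =
      (List.range' (r + 1 - m) m).reverse := by
    intro m hm
    rw [List.take_reverse, List.range_eq_range', List.drop_range', List.length_range']
    congr 2 <;> omega
  have key : ∀ k ≤ r, aApplyB κ rk (((List.range (r + 1)).drop (r - k)).foldr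
      (fun k acc => (List.range (r + 1)).reverse.take (k + 1) ++ acc) []) w =
      rvacStage κ r rk w k := by
    intro k
    induction k with
    | zero =>
      intro _
      have : (List.range (r + 1)).drop (r - 0) = [r] := by
        rw [List.range_eq_range', List.drop_range']
        simp
      rw [this, List.foldr_cons, List.foldr_nil, List.append_nil, take_eq _ le_rfl, rvacStage,
        sweep, Nat.sub_self]
    | succ k ih =>
      intro hk
      have : (List.range (r + 1)).drop (r - (k + 1)) =
          (r - (k + 1)) :: (List.range (r + 1)).drop (r - k) := by
        rw [List.drop_eq_getElem_cons (by simp), List.getElem_range]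
        congr 2
        omega
      rw [this, List.foldr_cons, aApplyB_append, ih (by omega), take_eq _ (by omega), rvacStage,
        sweep]
      congr 3 <;> omega
  have := key r le_rfl
  rwa [Nat.sub_self, List.drop_zero] at this

end DownUp

namespace IsGradedPoset

variable {P : Type} [Fintype P] [PartialOrder P] {r : ℕ} {rk : P → ℕ}

theorem downSum_eq (h : IsGradedPoset r rk) (w : P → ℝ) (y : P) :
    downSum rk w y = w y * lowSum rk w y := by
  rw [downSum, lowSum]
  rcases hn : rk y with _ | n
  · simp [pathSum]
  · rw [pathSum, if_neg (Nat.succ_ne_zero n)]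
    congr 1
    refine Finset.sum_congr rfl fun x hx => ?_
    have := h.rk_covBy _ _ (Finset.mem_filter.1 hx).2
    rw [downSum, show rk x = n by omega]

theorem upSum_eq (h : IsGradedPoset r rk) (w : P → ℝ) (y : P) :
    upSum r rk w y = w y * highSum r rk w y := by
  have hy := h.rk_le y
  rw [upSum, highSum]
  rcases hn : r - rk y with _ | n
  · rw [if_pos (by omega), pathSum, mul_one]
  · rw [pathSum, if_neg (by omega)]
    congr 1
    refine Finset.sum_congr rfl fun x hx => ?_
    have := h.rk_covBy _ _ (Finset.mem_filter.1 hx).2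
    rw [upSum, show r - rk x = n by omega]

theorem chainSum_eq (h : IsGradedPoset r rk) {w : P → ℝ} (hw : ∀ x, 0 < w x) (y : P) :
    chainSum w y = lowSum rk w y * w y * highSum r rk w y := by
  refine mul_right_cancel₀ (hw y).ne' ?_
  rw [h.chainSum_mul, ← downSum, ← upSum, h.downSum_eq, h.upSum_eq]
  ring

theorem downSum_pos (h : IsGradedPoset r rk) {w : P → ℝ} (hw : ∀ x, 0 < w x) (y : P) :
    0 < downSum rk w y := by
  induction hn : rk y generalizing y with
  | zero => simpa [downSum, hn, pathSum] using hw y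
  | succ n ih =>
    rw [h.downSum_eq, lowSum, if_neg (by omega)]
    obtain ⟨x, hx⟩ := h.exists_covBy_below (x := y) (by omega)
    refine mul_pos (hw y) (Finset.sum_pos (fun z hz => ih z ?_) ⟨x, by simpa using hx⟩)
    have := h.rk_covBy _ _ (Finset.mem_filter.1 hz).2
    omega

theorem upSum_pos (h : IsGradedPoset r rk) {w : P → ℝ} (hw : ∀ x, 0 < w x) (y : P) :
    0 < upSum r rk w y := by
  induction hn : r - rk y generalizing y with
  | zero => simpa [upSum, hn, pathSum] using hw y
  | succ n ih =>
    rw [h.upSum_eq, highSum, if_neg (by omega)]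
    obtain ⟨x, hx⟩ := h.exists_covBy_above (x := y) (by omega)
    refine mul_pos (hw y) (Finset.sum_pos (fun z hz => ih z ?_) ⟨x, by simpa using hx⟩)
    have := h.rk_covBy _ _ (Finset.mem_filter.1 hz).2
    omega

theorem lowSum_pos (h : IsGradedPoset r rk) {w : P → ℝ} (hw : ∀ x, 0 < w x) (y : P) :
    0 < lowSum rk w y :=
  pos_of_mul_pos_right (h.downSum_eq w y ▸ h.downSum_pos hw y) (hw y).le

theorem highSum_pos (h : IsGradedPoset r rk) {w : P → ℝ} (hw : ∀ x, 0 < w x) (y : P) :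
    0 < highSum r rk w y :=
  pos_of_mul_pos_right (h.upSum_eq w y ▸ h.upSum_pos hw y) (hw y).le

theorem downSum_congr (h : IsGradedPoset r rk) {w w' : P → ℝ} (y : P)
    (hw : ∀ x, rk x ≤ rk y → w x = w' x) : downSum rk w y = downSum rk w' y := by
  induction hn : rk y generalizing y with
  | zero => simpa [downSum, hn, pathSum] using hw y le_rfl
  | succ n ih =>
    rw [h.downSum_eq, h.downSum_eq, hw y le_rfl, lowSum, lowSum, if_neg (by omega),
      if_neg (by omega)]
    congr 1
    refine Finset.sum_congr rfl fun z hz => ?_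
    have := h.rk_covBy _ _ (Finset.mem_filter.1 hz).2
    exact ih z (fun x hx => hw x (by omega)) (by omega)

theorem upSum_congr (h : IsGradedPoset r rk) {w w' : P → ℝ} (y : P)
    (hw : ∀ x, rk y ≤ rk x → w x = w' x) : upSum r rk w y = upSum r rk w' y := by
  induction hn : r - rk y generalizing y with
  | zero => simpa [upSum, hn, pathSum] using hw y le_rfl
  | succ n ih =>
    rw [h.upSum_eq, h.upSum_eq, hw y le_rfl, highSum, highSum, if_neg (by omega),
      if_neg (by omega)]
    congr 1
    refine Finset.sum_congr rfl fun z hz => ?_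
    have := h.rk_covBy _ _ (Finset.mem_filter.1 hz).2
    exact ih z (fun x hx => hw x (by omega)) (by omega)

theorem lowSum_congr (h : IsGradedPoset r rk) {w w' : P → ℝ} (y : P)
    (hw : ∀ x, rk x < rk y → w x = w' x) : lowSum rk w y = lowSum rk w' y := by
  rw [lowSum, lowSum]
  congr 1
  refine Finset.sum_congr rfl fun z hz => h.downSum_congr z fun x hx => hw x ?_
  have := h.rk_covBy _ _ (Finset.mem_filter.1 hz).2
  omega

theorem highSum_congr (h : IsGradedPoset r rk) {w w' : P → ℝ} (y : P)
    (hw : ∀ x, rk y < rk x → w x = w' x) : highSum r rk w y = highSum r rk w' y := by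
  rw [highSum, highSum]
  congr 1
  refine Finset.sum_congr rfl fun z hz => h.upSum_congr z fun x hx => hw x ?_
  have := h.rk_covBy _ _ (Finset.mem_filter.1 hz).2
  omega

theorem eq_of_downSum_eq (h : IsGradedPoset r rk) {w w' : P → ℝ} (hw : ∀ x, 0 < w x)
    (hd : ∀ y, downSum rk w y = downSum rk w' y) : w = w' := by
  funext y
  have hl : lowSum rk w y = lowSum rk w' y := by simp only [lowSum, hd]
  have := hd y
  rw [h.downSum_eq, h.downSum_eq, ← hl] at this
  exact mul_right_cancel₀ (h.lowSum_pos hw y).ne' this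

theorem arankToggleB_pos (h : IsGradedPoset r rk) {κ : ℝ} (hκ : 0 < κ) {w : P → ℝ}
    (hw : ∀ x, 0 < w x) (i : ℕ) (x : P) : 0 < arankToggleB κ rk i w x := by
  rw [arankToggleB]
  split_ifs
  · rw [h.chainSum_eq hw]
    exact div_pos hκ (mul_pos (mul_pos (h.lowSum_pos hw x) (hw x)) (h.highSum_pos hw x))
  · exact hw x

theorem aApplyB_pos (h : IsGradedPoset r rk) {κ : ℝ} (hκ : 0 < κ) {w : P → ℝ}
    (hw : ∀ x, 0 < w x) (u : List ℕ) : ∀ x, 0 < aApplyB κ rk u w x := by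
  induction u with
  | nil => exact hw
  | cons i u ih => exact h.arankToggleB_pos hκ ih i

theorem arankToggleB_arankToggleB (h : IsGradedPoset r rk) {κ : ℝ} (hκ : 0 < κ) {w : P → ℝ}
    (hw : ∀ x, 0 < w x) (i : ℕ) : arankToggleB κ rk i (arankToggleB κ rk i w) = w := by
  have hpos := h.arankToggleB_pos hκ hw i
  have hne : ∀ x, rk x ≠ i → arankToggleB κ rk i w x = w x := fun x hx => if_neg hx
  funext x
  by_cases hx : rk x = i
  · rw [arankToggleB, if_pos hx, h.chainSum_eq hpos,
      h.lowSum_congr x (fun z hz => hne z (by omega)),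
      h.highSum_congr x (fun z hz => hne z (by omega)), arankToggleB, if_pos hx, h.chainSum_eq hw]
    have := h.lowSum_pos hw x
    have := h.highSum_pos hw x
    have := hw x
    field_simp
  · rw [arankToggleB, if_neg hx, hne x hx]

theorem aApplyB_reverse_aApplyB (h : IsGradedPoset r rk) {κ : ℝ} (hκ : 0 < κ) {w : P → ℝ}
    (hw : ∀ x, 0 < w x) (u : List ℕ) : aApplyB κ rk u.reverse (aApplyB κ rk u w) = w := by
  induction u with
  | nil => rfl
  | cons i u ih =>
    rw [List.reverse_cons, aApplyB_append]
    simp only [aApplyB]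
    rw [h.arankToggleB_arankToggleB hκ (h.aApplyB_pos hκ hw u), ih]

theorem downSum_sweep (h : IsGradedPoset r rk) {κ : ℝ} (hκ : 0 < κ) {w : P → ℝ}
    (hw : ∀ x, 0 < w x) (k n : ℕ) (y : P) (hk : k ≤ rk y) (hn : rk y < k + n) :
    downSum rk (sweep κ rk k n w) y = κ / upSum r rk w y := by
  induction n with
  | zero => omega
  | succ n ih =>
    have hne : ∀ x, rk x ≠ k + n → sweep κ rk k (n + 1) w x = sweep κ rk k n w x := fun x hx => by
      rw [sweep_succ, arankToggleB, if_neg hx]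
    rcases Nat.lt_or_ge (rk y) (k + n) with hlt | hge
    · rw [h.downSum_congr y (fun x hx => hne x (by omega)), ih hlt]
    · have hpos : ∀ x, 0 < sweep κ rk k n w x := h.aApplyB_pos hκ hw _
      rw [h.downSum_eq, h.lowSum_congr y (fun x hx => hne x (by omega)), sweep_succ, arankToggleB,
        if_pos (by omega), h.chainSum_eq hpos, h.upSum_eq,
        h.highSum_congr y (fun x hx => sweep_of_notMem κ rk k n w x (by omega)),
        sweep_of_notMem κ rk k n w y (by omega)]
      have := h.lowSum_pos hpos y
      have := h.highSum_pos hw y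
      have := hw y
      field_simp

theorem rvacStage_pos (h : IsGradedPoset r rk) {κ : ℝ} (hκ : 0 < κ) {w : P → ℝ}
    (hw : ∀ x, 0 < w x) (k : ℕ) : ∀ x, 0 < rvacStage κ r rk w k x := by
  induction k with
  | zero => exact h.aApplyB_pos hκ hw _
  | succ k ih => exact h.aApplyB_pos hκ ih _

theorem downSum_rvacStage_succ (h : IsGradedPoset r rk) {κ : ℝ} (hκ : 0 < κ) {w : P → ℝ}
    (hw : ∀ x, 0 < w x) (k : ℕ) (y : P) (hk : k + 1 ≤ rk y) :
    downSum rk (rvacStage κ r rk w (k + 1)) y = κ / upSum r rk (rvacStage κ r rk w k) y := by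
  have := h.rk_le y
  exact h.downSum_sweep hκ (h.rvacStage_pos hκ hw k) _ _ y hk (by omega)

end IsGradedPoset

/-- `e` identifies `Q` with the elements of positive rank of `P`, the ranks being shifted by `1`. -/
structure IsPositiveRankPart {P Q : Type} [PartialOrder P] [PartialOrder Q] (rk : P → ℕ)
    (rkQ : Q → ℕ) (e : Q → P) : Prop where
  rk_apply : ∀ q, rk (e q) = rkQ q + 1
  injective : Function.Injective e
  exists_apply_eq : ∀ y, 1 ≤ rk y → ∃ q, e q = y
  covBy_iff : ∀ q q', e q ⋖ e q' ↔ q ⋖ q'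

namespace IsPositiveRankPart

variable {P Q : Type} [Fintype P] [Fintype Q] [PartialOrder P] [PartialOrder Q] {s : ℕ}
  {rk : P → ℕ} {rkQ : Q → ℕ} {e : Q → P}

theorem sum_covBy_below (he : IsPositiveRankPart rk rkQ e) (hP : IsGradedPoset (s + 1) rk)
    (F : P → ℝ) (q : Q) (hq : 1 ≤ rkQ q) :
    ∑ x ∈ Finset.univ.filter (fun x => x ⋖ e q), F x =
      ∑ p ∈ Finset.univ.filter (fun p => p ⋖ q), F (e p) := by
  symm
  refine Finset.sum_nbij e (fun p hp => ?_) he.injective.injOn (fun x hx => ?_) fun _ _ => rfl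
  · simpa [he.covBy_iff] using hp
  · have hx' : x ⋖ e q := by simpa using hx
    have := hP.rk_covBy _ _ hx'
    obtain ⟨p, rfl⟩ := he.exists_apply_eq x (by rw [he.rk_apply] at this; omega)
    exact ⟨p, by simpa [he.covBy_iff] using hx', rfl⟩

theorem sum_covBy_above (he : IsPositiveRankPart rk rkQ e) (hP : IsGradedPoset (s + 1) rk)
    (F : P → ℝ) (q : Q) :
    ∑ x ∈ Finset.univ.filter (fun x => e q ⋖ x), F x =
      ∑ p ∈ Finset.univ.filter (fun p => q ⋖ p), F (e p) := by
  symm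
  refine Finset.sum_nbij e (fun p hp => ?_) he.injective.injOn (fun x hx => ?_) fun _ _ => rfl
  · simpa [he.covBy_iff] using hp
  · have hx' : e q ⋖ x := by simpa using hx
    have := hP.rk_covBy _ _ hx'
    obtain ⟨p, rfl⟩ := he.exists_apply_eq x (by omega)
    exact ⟨p, by simpa [he.covBy_iff] using hx', rfl⟩

theorem upSum_apply (he : IsPositiveRankPart rk rkQ e) (hP : IsGradedPoset (s + 1) rk)
    (w : P → ℝ) (q : Q) : upSum (s + 1) rk w (e q) = upSum s rkQ (fun q => w (e q)) q := by
  have : ∀ n q, pathSum (fun x z => z ⋖ x) w n (e q) =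
      pathSum (fun x z => z ⋖ x) (fun q => w (e q)) n q := by
    intro n
    induction n with
    | zero => exact fun _ => rfl
    | succ n ih =>
      intro q
      rw [pathSum, pathSum, he.sum_covBy_above hP]
      simp only [ih]
  rw [upSum, upSum, this, he.rk_apply, Nat.add_sub_add_right]

theorem highSum_apply (he : IsPositiveRankPart rk rkQ e) (hP : IsGradedPoset (s + 1) rk)
    (w : P → ℝ) (q : Q) : highSum (s + 1) rk w (e q) = highSum s rkQ (fun q => w (e q)) q := by
  rw [highSum, highSum, he.sum_covBy_above hP, he.rk_apply]
  simp only [he.upSum_apply hP, Nat.add_right_cancel_iff]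

theorem apply_eq_of_downSum_eq (he : IsPositiveRankPart rk rkQ e) (hP : IsGradedPoset (s + 1) rk)
    (hQ : IsGradedPoset s rkQ) {w : P → ℝ} {v : Q → ℝ} (hw : ∀ x, 0 < w x) (k : ℕ)
    (hd : ∀ q, k ≤ rkQ q → downSum rk w (e q) = downSum rkQ v q) (q : Q) (hq : k < rkQ q) :
    w (e q) = v q := by
  have hl : lowSum rk w (e q) = lowSum rkQ v q := by
    rw [lowSum, lowSum, if_neg (by rw [he.rk_apply]; omega), if_neg (by omega),
      he.sum_covBy_below hP _ _ (by omega)]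
    refine Finset.sum_congr rfl fun p hp => hd p ?_
    have := hQ.rk_covBy _ _ (Finset.mem_filter.1 hp).2
    omega
  have := hd q hq.le
  rw [hP.downSum_eq, hQ.downSum_eq, ← hl] at this
  exact mul_right_cancel₀ (hP.lowSum_pos hw _).ne' this

variable {κ : ℝ} {w : P → ℝ}

theorem downSum_rvacStage_apply (he : IsPositiveRankPart rk rkQ e)
    (hP : IsGradedPoset (s + 1) rk) (hQ : IsGradedPoset s rkQ) (hκ : 0 < κ) (hw : ∀ x, 0 < w x)
    (k : ℕ) (q : Q) (hq : k ≤ rkQ q) :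
    downSum rk (rvacStage κ (s + 1) rk w k) (e q) =
      downSum rkQ (rvacStage κ s rkQ (fun q => w (e q)) k) q := by
  have hv : ∀ q, 0 < w (e q) := fun q => hw _
  induction k generalizing q with
  | zero =>
    have h1 := hP.rk_le (e q)
    have h2 := hQ.rk_le q
    rw [rvacStage, rvacStage, hP.downSum_sweep hκ hw _ _ _ (Nat.zero_le _) (by omega),
      hQ.downSum_sweep hκ hv _ _ _ (Nat.zero_le _) (by omega), he.upSum_apply hP]
  | succ k ih =>
    rw [hP.downSum_rvacStage_succ hκ hw _ _ (by rw [he.rk_apply]; omega),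
      hQ.downSum_rvacStage_succ hκ hv _ _ hq, he.upSum_apply hP]
    congr 1
    exact hQ.upSum_congr q fun x hx =>
      he.apply_eq_of_downSum_eq hP hQ (hP.rvacStage_pos hκ hw k) k ih x (by omega)

theorem rvacStage_apply (he : IsPositiveRankPart rk rkQ e)
    (hP : IsGradedPoset (s + 1) rk) (hQ : IsGradedPoset s rkQ) (hκ : 0 < κ) (hw : ∀ x, 0 < w x)
    (q : Q) :
    rvacStage κ (s + 1) rk w (s + 1) (e q) =
      κ / (downSum rkQ (rvacStage κ s rkQ (fun q => w (e q)) (rkQ q)) q *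
        highSum s rkQ (rvacStage κ s rkQ (fun q => w (e q)) (rkQ q)) q) := by
  have hq := hQ.rk_le q
  have hrk := he.rk_apply q
  set j := rkQ q with hj
  have hS := hP.rvacStage_pos hκ hw j
  have hS' := hP.rvacStage_pos hκ hw (j + 1)
  have hhigh : highSum (s + 1) rk (rvacStage κ (s + 1) rk w j) (e q) =
      highSum s rkQ (rvacStage κ s rkQ (fun q => w (e q)) j) q := by
    rw [he.highSum_apply hP]
    exact hQ.highSum_congr q fun x hx => he.apply_eq_of_downSum_eq hP hQ hS j
      (fun q hq => he.downSum_rvacStage_apply hP hQ hκ hw j q hq) x hx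
  have hlow : lowSum rk (rvacStage κ (s + 1) rk w (j + 1)) (e q) =
      lowSum rk (rvacStage κ (s + 1) rk w j) (e q) :=
    hP.lowSum_congr _ fun x hx => rvacStage_eq_of_le _ _ _ _ (Nat.le_succ j) x (by omega)
  have hd := hP.downSum_rvacStage_succ hκ hw j (e q) (by omega)
  rw [hP.downSum_eq, hP.upSum_eq, hlow] at hd
  rw [rvacStage_eq_of_le κ (s + 1) rk w (show j + 1 ≤ s + 1 by omega) (e q) (by omega),
    ← he.downSum_rvacStage_apply hP hQ hκ hw j q le_rfl, ← hhigh, hP.downSum_eq]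
  have h1 := hS (e q)
  have h2 := hP.lowSum_pos hS (e q)
  have h3 := hP.highSum_pos hS (e q)
  rw [eq_div_iff (by positivity)] at hd ⊢
  linear_combination hd

theorem upSum_rvacStage (he : IsPositiveRankPart rk rkQ e)
    (hP : IsGradedPoset (s + 1) rk) (hQ : IsGradedPoset s rkQ) (hκ : 0 < κ) (hw : ∀ x, 0 < w x)
    (q : Q) :
    upSum s rkQ (fun q => rvacStage κ (s + 1) rk w (s + 1) (e q)) q =
      κ / downSum rkQ (rvacStage κ s rkQ (fun q => w (e q)) s) q := by
  have hv : ∀ q, 0 < w (e q) := fun q => hw _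
  have final : ∀ q, downSum rkQ (rvacStage κ s rkQ (fun q => w (e q)) s) q =
      downSum rkQ (rvacStage κ s rkQ (fun q => w (e q)) (rkQ q)) q := fun q =>
    hQ.downSum_congr q fun x hx => rvacStage_eq_of_le _ _ _ _ (hQ.rk_le q) x hx
  induction hn : s - rkQ q generalizing q with
  | zero =>
    have hs : rkQ q = s := by
      have := hQ.rk_le q
      omega
    rw [hQ.upSum_eq, he.rvacStage_apply hP hQ hκ hw, final, highSum, highSum, if_pos hs, if_pos hs,
      mul_one, mul_one]
  | succ n ih =>
    have hhigh : highSum s rkQ (fun q => rvacStage κ (s + 1) rk w (s + 1) (e q)) q =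
        highSum s rkQ (rvacStage κ s rkQ (fun q => w (e q)) (rkQ q)) q := by
      rw [highSum, highSum]
      congr 1
      refine Finset.sum_congr rfl fun z hz => ?_
      have hz' := hQ.rk_covBy _ _ (Finset.mem_filter.1 hz).2
      rw [ih z (by omega), final, hz', hQ.downSum_rvacStage_succ hκ hv _ _ hz'.ge,
        div_div_cancel₀ hκ.ne']
    have h1 := hQ.downSum_pos (hQ.rvacStage_pos hκ hv (rkQ q)) q
    have h2 := hQ.highSum_pos (hQ.rvacStage_pos hκ hv (rkQ q)) q
    rw [hQ.upSum_eq, hhigh, he.rvacStage_apply hP hQ hκ hw, final]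
    field_simp

theorem RowAB_RvacAB (he : IsPositiveRankPart rk rkQ e)
    (hP : IsGradedPoset (s + 1) rk) (hQ : IsGradedPoset s rkQ) (hκ : 0 < κ) (hw : ∀ x, 0 < w x) :
    RowAB κ rkQ s (fun q => RvacAB κ rk (s + 1) w (e q)) = RvacAB κ rkQ s (fun q => w (e q)) := by
  have hpos : ∀ q, 0 < RvacAB κ rk (s + 1) w (e q) := fun q => hP.aApplyB_pos hκ hw _ _
  refine hQ.eq_of_downSum_eq (hQ.aApplyB_pos hκ hpos _) fun q => ?_
  rw [RowAB_eq_sweep, hQ.downSum_sweep hκ hpos _ _ q (Nat.zero_le _)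
    (by have := hQ.rk_le q; omega)]
  simp only [RvacAB_eq_rvacStage]
  rw [he.upSum_rvacStage hP hQ hκ hw, div_div_cancel₀ hκ.ne']

theorem RvacAB_apply (he : IsPositiveRankPart rk rkQ e)
    (hP : IsGradedPoset (s + 1) rk) (hQ : IsGradedPoset s rkQ) (hκ : 0 < κ) (hw : ∀ x, 0 < w x)
    (q : Q) :
    RvacAB κ rk (s + 1) w (e q) =
      aApplyB κ rkQ ((arowWordB s).reverse ++ arvacWordB s) (fun q => w (e q)) q := by
  have hpos : ∀ q, 0 < RvacAB κ rk (s + 1) w (e q) := fun q => hP.aApplyB_pos hκ hw _ _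
  rw [aApplyB_append, ← RvacAB, ← he.RowAB_RvacAB hP hQ hκ hw, RowAB,
    hQ.aApplyB_reverse_aApplyB hκ hpos]

end IsPositiveRankPart

namespace IsGradedPoset

variable {P : Type} [Fintype P] [PartialOrder P] {r : ℕ} {rk : P → ℕ}

theorem RvacAB_of_rk_eq_zero (κ : ℝ) (w : P → ℝ) {x : P} (hx : rk x = 0) :
    RvacAB κ rk r w x = arankToggleB κ rk 0 w x := by
  rw [RvacAB_eq_rvacStage, rvacStage_eq_of_le κ r rk w (Nat.zero_le r) x hx.le, rvacStage]
  induction r with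
  | zero => rw [sweep_succ, sweep_zero]
  | succ r ih => rw [sweep_succ, arankToggleB, if_neg (by omega), ih]

theorem isPositiveRankPart (h : IsGradedPoset r rk) :
    IsPositiveRankPart rk (fun y : {y : P // 1 ≤ rk y} => rk y.val - 1) Subtype.val where
  rk_apply q := by
    have := q.2
    omega
  injective := Subtype.val_injective
  exists_apply_eq y hy := ⟨⟨y, hy⟩, rfl⟩
  covBy_iff q q' := by
    refine ⟨fun hqq => ⟨hqq.1, fun z h1 h2 => hqq.2 (c := z.val) h1 h2⟩,
      fun hqq => ⟨hqq.1, fun z h1 h2 => hqq.2 (c := ⟨z, ?_⟩) h1 h2⟩⟩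
    exact q.2.trans (h.strictMono h1).le

theorem positiveRankPart (h : IsGradedPoset r rk) :
    IsGradedPoset (r - 1) (fun y : {y : P // 1 ≤ rk y} => rk y.val - 1) where
  rk_of_isMin q hq := by
    by_contra hne
    obtain ⟨y, hy⟩ := h.exists_covBy_below (x := q.val) (by omega)
    have hrk := h.rk_covBy _ _ hy
    exact hq.not_lt (b := ⟨y, by omega⟩) hy.lt
  rk_covBy q q' hqq := by
    have := h.rk_covBy _ _ ((h.isPositiveRankPart.covBy_iff q q').2 hqq)
    have := q.2
    omega
  rk_of_isMax q hq := by
    rw [h.rk_of_isMax q.val fun y hy => ?_]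
    exact hq (b := ⟨y, q.2.trans (h.strictMono.monotone hy)⟩) hy

end IsGradedPoset

/-- recursive description of birational antichain rowvacuation.
Let `P` be a graded poset of rank `r ≥ 1`, `κ > 0`, `π ∈ A^B_κ(P)` and `x ∈ P`.
If `rk x = 0` then `(Rvac^B_A π)(x) = (𝛕_0 π)(x)`.  If `rk x ≥ 1` then
`(Rvac^B_A π)(x) = ((Row^B_A)⁻¹ (Rvac^B_A π̄))(x)`, where `π̄` is the restriction of `π`
to the subposet `P_{≥1}` (a graded poset of rank `r-1`, with rank function `rk - 1`),
and on the right-hand side the operators are those of `P_{≥1}`;  here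
`(Row^B_A)⁻¹ ∘ Rvac^B_A` on `P_{≥1}` is the composite of the toggle word
`(𝛕_0 𝛕_1 ⋯ 𝛕_{r-1})` (the inverse of rowmotion) after the rowvacuation word. -/
theorem stmt5 {P : Type} [Fintype P] [PartialOrder P] [Nonempty P]
    (r : ℕ) (hr : 1 ≤ r) (rk : P → ℕ)
    (hmin : ∀ x : P, IsMin x → rk x = 0)
    (hcov : ∀ x y : P, x ⋖ y → rk y = rk x + 1)
    (hmax : ∀ x : P, IsMax x → rk x = r)
    (κ : ℝ) (hκ : 0 < κ)
    (π : P → ℝ) (hpos : ∀ x, 0 < π x) (x : P) :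
    (rk x = 0 → RvacAB κ rk r π x = arankToggleB κ rk 0 π x) ∧
    (∀ h : 1 ≤ rk x,
      RvacAB κ rk r π x =
        aApplyB (P := {y : P // 1 ≤ rk y}) κ (fun y => rk y.val - 1)
          ((arowWordB (r - 1)).reverse ++ arvacWordB (r - 1))
          (fun y => π y.val) ⟨x, h⟩) := by
  have hP : IsGradedPoset r rk := ⟨hmin, hcov, hmax⟩
  refine ⟨fun hx => IsGradedPoset.RvacAB_of_rk_eq_zero κ π hx, fun h => ?_⟩
  obtain ⟨s, rfl⟩ : ∃ s, r = s + 1 := ⟨r - 1, by omega⟩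
  exact hP.isPositiveRankPart.RvacAB_apply hP hP.positiveRankPart hκ hpos ⟨x, h⟩
end
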